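/- arXiv:2210.07950 — 6 statements merged into one kernel-verified Lean document; each statement's English description precedes it below -/
import Mathlib

section
/- Let m ≥ 1 and λ > ω_{r,m} := 2m r₀. Then for all 0 < x₀ < x₁ ≤ ∞: ∫_{x₀}^{x₁} e^{−λR(s)} (1+s^m)/r(s) ds ≤ (1/(λ − ω_{r,m})) · e^{−λR(x₀)} (1+x₀^m). -/
open MeasureTheory Set Filter

theorem intervalIntegrable_of_integrableOn_of_continuousOn {f : ℝ → ℝ} {a x : ℝ}
    (ha : 0 < a) (hx : 0 < x) (hf : IntegrableOn f (Ioo 0 a)) (hc : ContinuousOn f (Ioi 0)) :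
    IntervalIntegrable f volume 0 x := by
  have h₁ : IntervalIntegrable f volume 0 a := by
    rwa [intervalIntegrable_iff_integrableOn_Ioo_of_le ha.le]
  refine h₁.trans (ContinuousOn.intervalIntegrable (hc.mono fun y hy => ?_))
  exact (lt_min ha hx).trans_le hy.1

theorem hasDerivAt_setIntegral_Ioo {f F : ℝ → ℝ} {a : ℝ} (ha : 0 < a)
    (hf : IntegrableOn f (Ioo 0 a)) (hc : ContinuousOn f (Ioi 0))
    (hF : ∀ x, 0 < x → F x = ∫ s in Ioo (0 : ℝ) x, f s) {x : ℝ} (hx : 0 < x) :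
    HasDerivAt F (f x) x := by
  have hnhds : Ioi (0 : ℝ) ∈ nhds x := Ioi_mem_nhds hx
  have h := intervalIntegral.integral_hasDerivAt_right
    (intervalIntegrable_of_integrableOn_of_continuousOn ha hx hf hc)
    (hc.stronglyMeasurableAtFilter isOpen_Ioi x hx) (hc.continuousAt hnhds)
  refine h.congr_of_eventuallyEq ?_
  filter_upwards [hnhds] with y hy
  rw [hF y hy, intervalIntegral.integral_of_le (le_of_lt hy), integral_Ioc_eq_integral_Ioo]

theorem rpow_sub_one_le_one_add_rpow {m x : ℝ} (hm : 1 ≤ m) (hx : 0 < x) :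
    x ^ (m - 1) ≤ 1 + x ^ m := by
  rcases le_total x 1 with h | h
  · linarith [Real.rpow_le_one hx.le h (sub_nonneg.2 hm), Real.rpow_nonneg hx.le m]
  · linarith [Real.rpow_le_rpow_of_exponent_le h (sub_le_self m zero_le_one)]

theorem mul_rpow_sub_one_mul_le {m r₀ x y : ℝ} (hm : 1 ≤ m) (hr₀ : 0 ≤ r₀) (hx : 0 < x)
    (hy : y ≤ r₀ * (1 + x)) :
    m * x ^ (m - 1) * y ≤ 2 * m * r₀ * (1 + x ^ m) := by
  have hpow : x ^ (m - 1) * x = x ^ m := by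
    rw [← Real.rpow_add_one hx.ne', sub_add_cancel]
  have hm0 : 0 ≤ m := zero_le_one.trans hm
  calc m * x ^ (m - 1) * y ≤ m * x ^ (m - 1) * (r₀ * (1 + x)) := by gcongr
    _ = m * r₀ * (x ^ (m - 1) + x ^ m) := by rw [← hpow]; ring
    _ ≤ m * r₀ * ((1 + x ^ m) + (1 + x ^ m)) := by
        gcongr
        · exact rpow_sub_one_le_one_add_rpow hm hx
        · linarith
    _ = 2 * m * r₀ * (1 + x ^ m) := by ring

/-- The estimate `P_{m,1}(x₀,x₁) ≤ e^{-λR(x₀)}(1+x₀^m)/(λ-ω_{r,m})`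
for all `0 < x₀ < x₁ ≤ ∞`, where `R(x) = ∫₀^x ds/r(s)` and `ω_{r,m} = 2 m r₀`. -/
theorem Pm1_estimate (m r₀ lam : ℝ) (r R : ℝ → ℝ)
    (hm : 1 ≤ m) (hr₀ : 0 < r₀)
    (hr_cont : ContinuousOn r (Ioi 0))
    (hr_pos : ∀ x, 0 < x → 0 < r x)
    (hr_bound : ∀ x, 0 < x → r x ≤ r₀ * (1 + x))
    (hr_int : IntegrableOn (fun s => 1 / r s) (Ioo 0 1))
    (hR : ∀ x, 0 < x → R x = ∫ s in Ioo (0:ℝ) x, 1 / r s)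
    (hlam : 2 * m * r₀ < lam) :
    (∀ x₀ x₁ : ℝ, 0 < x₀ → x₀ < x₁ →
      ∫⁻ s in Ioo x₀ x₁,
          ENNReal.ofReal (Real.exp (-(lam * R s)) * (1 + s ^ m) / r s)
        ≤ ENNReal.ofReal
            (1 / (lam - 2 * m * r₀) * Real.exp (-(lam * R x₀)) * (1 + x₀ ^ m))) ∧
    (∀ x₀ : ℝ, 0 < x₀ →
      ∫⁻ s in Ioi x₀,
          ENNReal.ofReal (Real.exp (-(lam * R s)) * (1 + s ^ m) / r s)
        ≤ ENNReal.ofReal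
            (1 / (lam - 2 * m * r₀) * Real.exp (-(lam * R x₀)) * (1 + x₀ ^ m))) := by
  have hinv : ContinuousOn (fun s => 1 / r s) (Ioi 0) :=
    continuousOn_const.div hr_cont fun x hx => (hr_pos x hx).ne'
  have hRd : ∀ x, 0 < x → HasDerivAt R (1 / r x) x := fun x hx =>
    hasDerivAt_setIntegral_Ioo one_pos hr_int hinv hR hx
  have hc : 0 < lam - 2 * m * r₀ := sub_pos.2 hlam
  set G : ℝ → ℝ := fun x => 1 / (lam - 2 * m * r₀) * Real.exp (-(lam * R x)) * (1 + x ^ m)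
  have hGd : ∀ x, 0 < x → HasDerivAt (fun x => -G x)
      (1 / (lam - 2 * m * r₀) * Real.exp (-(lam * R x)) *
        (lam * (1 + x ^ m) / r x - m * x ^ (m - 1))) x := by
    intro x hx
    have h := ((((hRd x hx).const_mul lam).neg.exp.const_mul (1 / (lam - 2 * m * r₀))).mul
      ((Real.hasDerivAt_rpow_const (p := m) (Or.inl hx.ne')).const_add 1)).neg
    refine h.congr_deriv ?_
    simp only [Pi.neg_apply]
    ring
  have hGnn : ∀ x, 0 < x → 0 ≤ G x := fun x hx => by
    have := Real.rpow_nonneg hx.le m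
    positivity
  set φ : ℝ → ℝ := fun s => Real.exp (-(lam * R s)) * (1 + s ^ m) / r s with hφ
  have hφc : ContinuousOn φ (Ioi 0) := by
    have hRc : ContinuousOn R (Ioi 0) := fun x hx => (hRd x hx).continuousAt.continuousWithinAt
    have hpow : ContinuousOn (fun s : ℝ => s ^ m) (Ioi 0) :=
      continuousOn_id.rpow_const fun x hx => Or.inl (ne_of_gt hx)
    exact ((continuousOn_const.mul hRc).neg.rexp.mul (continuousOn_const.add hpow)).div hr_cont
      fun x hx => (hr_pos x hx).ne'
  have hφnn : ∀ x, 0 < x → 0 ≤ φ x := fun x hx => by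
    have := Real.rpow_nonneg hx.le m
    have := hr_pos x hx
    positivity
  have hφle : ∀ x, 0 < x → φ x ≤ 1 / (lam - 2 * m * r₀) * Real.exp (-(lam * R x)) *
      (lam * (1 + x ^ m) / r x - m * x ^ (m - 1)) := by
    intro x hx
    have hrx := hr_pos x hx
    have hkey := mul_rpow_sub_one_mul_le hm hr₀.le hx (hr_bound x hx)
    have hle : (lam - 2 * m * r₀) * ((1 + x ^ m) / r x) ≤
        lam * (1 + x ^ m) / r x - m * x ^ (m - 1) := by
      rw [← mul_div_assoc, le_sub_iff_add_le, ← le_sub_iff_add_le', ← sub_div, le_div_iff₀ hrx]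
      linarith
    calc φ x = 1 / (lam - 2 * m * r₀) * Real.exp (-(lam * R x)) *
          ((lam - 2 * m * r₀) * ((1 + x ^ m) / r x)) := by
            simp only [hφ]
            field_simp
      _ ≤ _ := by gcongr
  have hfin : ∀ x₀ x₁ : ℝ, 0 < x₀ → x₀ < x₁ →
      ∫⁻ s in Ioo x₀ x₁, ENNReal.ofReal (φ s) ≤ ENNReal.ofReal (G x₀) := by
    intro x₀ x₁ h₀ h₁
    have hsub : Icc x₀ x₁ ⊆ Ioi 0 := fun y hy => h₀.trans_le hy.1
    have hint : IntegrableOn φ (Icc x₀ x₁) := (hφc.mono hsub).integrableOn_Icc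
    have hle : ∫ s in x₀..x₁, φ s ≤ -G x₁ - -G x₀ :=
      intervalIntegral.integral_le_sub_of_hasDeriv_right_of_le h₁.le
        (fun y hy => (hGd y (hsub hy)).continuousAt.continuousWithinAt)
        (fun y hy => (hGd y (h₀.trans hy.1)).hasDerivWithinAt) hint
        (fun y hy => hφle y (h₀.trans hy.1))
    rw [intervalIntegral.integral_of_le h₁.le, integral_Ioc_eq_integral_Ioo] at hle
    rw [← ofReal_integral_eq_lintegral_ofReal (hint.mono_set Ioo_subset_Icc_self)
      (ae_restrict_of_forall_mem measurableSet_Ioo fun y hy => hφnn y (h₀.trans hy.1))]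
    exact ENNReal.ofReal_le_ofReal (by linarith [hGnn x₁ (h₀.trans h₁)])
  refine ⟨hfin, fun x₀ h₀ => ?_⟩
  have hmono : Monotone fun n : ℕ => Ioo x₀ (x₀ + (n + 1)) := fun a b hab =>
    Ioo_subset_Ioo_right (by gcongr)
  have hunion : ⋃ n : ℕ, Ioo x₀ (x₀ + (n + 1)) = Ioi x₀ := by
    ext y
    simp only [mem_iUnion, mem_Ioo, mem_Ioi]
    refine ⟨fun ⟨_, h⟩ => h.1, fun h => ?_⟩
    obtain ⟨n, hn⟩ := exists_nat_gt (y - x₀)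
    exact ⟨n, h, by linarith⟩
  rw [← hunion, setLIntegral_iUnion_of_directed _ hmono.directed_le]
  exact iSup_le fun n => hfin x₀ _ h₀ (by linarith [n.cast_nonneg (α := ℝ)])
end

section
/- Let m ≥ 1, let β : (0,∞) → [0,∞) be measurable with β(x) ≤ β_m (1+x^m) for a.e. x > 0, and let λ > ω_{r,m} + β_m. Then: (i) ∫₀^∞ e_λ(x)(1+x^m) dx ≤ 1/(λ − ω_{r,m}); (ii) ∫₀^∞ β(x) e_λ(x) dx ≤ β_m/(λ − ω_{r,m}) < 1; (iii) for every f ∈ X_m, the function E_λ f := e_λ · (∫₀^∞ β(y) f(y) dy)/(1 − ∫₀^∞ β(y) e_λ(y) dy) belongs to X_m and satisfies ‖E_λ f‖_m ≤ (β_m/(λ − ω_{r,m} − β_m)) ‖f‖_m. -/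
open MeasureTheory Set Filter

/-- `e_λ(x) = e^{-λR(x)-Q(x)}/r(x)`. -/
noncomputable def elam (r R Q : ℝ → ℝ) (lam x : ℝ) : ℝ :=
  Real.exp (-(lam * R x) - Q x) / r x

/-- `1 / r` is integrable on every bounded interval `(0, x)`. -/
lemma integrableOn_one_div_Ioo {r : ℝ → ℝ} (hr_cont : ContinuousOn r (Ioi 0))
    (hr_pos : ∀ x, 0 < x → 0 < r x)
    (hr_int : IntegrableOn (fun s => 1 / r s) (Ioo 0 1)) (x : ℝ) :
    IntegrableOn (fun s => 1 / r s) (Ioo 0 x) := by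
  have hc : ContinuousOn (fun s => 1 / r s) (Icc 1 x) :=
    continuousOn_const.div (hr_cont.mono fun s hs => lt_of_lt_of_le one_pos hs.1)
      fun s hs => (hr_pos s (lt_of_lt_of_le one_pos hs.1)).ne'
  refine (hr_int.union hc.integrableOn_Icc).mono_set fun s hs => ?_
  rcases lt_or_ge s 1 with h | h
  · exact Or.inl ⟨hs.1, h⟩
  · exact Or.inr ⟨h, hs.2.le⟩

/-- The primitive of a nonnegative function is measurable on `(0, ∞)`. -/
lemma aemeasurable_setIntegral_Ioo {u U : ℝ → ℝ} (hu : ∀ x, 0 < x → 0 ≤ u x)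
    (hint : ∀ x, 0 < x → IntegrableOn u (Ioo 0 x))
    (hU : ∀ x, 0 < x → U x = ∫ s in Ioo (0:ℝ) x, u s) :
    AEMeasurable U (volume.restrict (Ioi 0)) := by
  refine aemeasurable_restrict_of_monotoneOn measurableSet_Ioi fun x hx y hy hxy => ?_
  rw [hU x hx, hU y hy]
  refine setIntegral_mono_set (hint y hy) ?_ (Ioo_subset_Ioo_right hxy).eventuallyLE
  exact (ae_restrict_iff' measurableSet_Ioo).2 (Eventually.of_forall fun s hs => hu s hs.1)

/-- The weight `1 + x ^ m` grows at rate at most `2 m r₀` along the flow of `r`. -/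
lemma rpow_weight_growth {m r₀ x ρ : ℝ} (hm : 1 ≤ m) (hr₀ : 0 < r₀) (hx : 0 < x)
    (hρ : ρ ≤ r₀ * (1 + x)) :
    m * x ^ (m - 1) * ρ ≤ 2 * m * r₀ * (1 + x ^ m) := by
  have h0 : 0 ≤ x ^ (m - 1) := Real.rpow_nonneg hx.le _
  have hxm : x ^ (m - 1) * x = x ^ m := by
    rw [← Real.rpow_add_one hx.ne']; simp
  have hle : x ^ (m - 1) ≤ 1 + x ^ m := by
    rcases le_total x 1 with h | h
    · have := Real.rpow_le_one hx.le h (by linarith : 0 ≤ m - 1)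
      have := Real.rpow_nonneg hx.le m
      linarith
    · have := Real.rpow_le_rpow_of_exponent_le h (by linarith : m - 1 ≤ m)
      linarith
  have hmr : 0 ≤ m * r₀ := by positivity
  calc m * x ^ (m - 1) * ρ ≤ m * x ^ (m - 1) * (r₀ * (1 + x)) := by gcongr
    _ = m * r₀ * (x ^ (m - 1) + x ^ m) := by rw [← hxm]; ring
    _ ≤ m * r₀ * ((1 + x ^ m) + (1 + x ^ m)) := by
        refine mul_le_mul_of_nonneg_left ?_ hmr
        linarith
    _ = _ := by ring

/-- If `g ≤ 0` is continuous at `a` from the right with nonnegative derivative on `(a, ∞)`, then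
its derivative is integrable there with integral at most `-g a`. -/
lemma integral_Ioi_deriv_le_of_nonpos {g g' : ℝ → ℝ} {a : ℝ}
    (hcont : ContinuousWithinAt g (Ici a) a)
    (hderiv : ∀ x ∈ Ioi a, HasDerivAt g (g' x) x)
    (hg' : ∀ x ∈ Ioi a, 0 ≤ g' x) (hg : ∀ x ∈ Ioi a, g x ≤ 0) :
    IntegrableOn g' (Ioi a) ∧ ∫ x in Ioi a, g' x ≤ -g a := by
  have hcontOn : ContinuousOn g (Ici a) := by
    intro x hx
    rcases eq_or_lt_of_le (show a ≤ x from hx) with rfl | h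
    · exact hcont
    · exact (hderiv x h).continuousAt.continuousWithinAt
  have hmono : MonotoneOn g (Ici a) := by
    refine monotoneOn_of_deriv_nonneg (convex_Ici a) hcontOn ?_ ?_ <;> rw [interior_Ici]
    · exact fun x hx => (hderiv x hx).differentiableAt.differentiableWithinAt
    · intro x hx
      rw [(hderiv x hx).deriv]
      exact hg' x hx
  have hmono' : Monotone fun x => g (max a x) := fun x y hxy =>
    hmono (mem_Ici.2 (le_max_left a x)) (mem_Ici.2 (le_max_left a y)) (max_le_max le_rfl hxy)
  have hle : ∀ x, g (max a x) ≤ 0 := fun x =>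
    (hmono (mem_Ici.2 (le_max_left a x))
      (mem_Ici.2 ((le_max_left a x).trans (lt_add_one _).le)) (lt_add_one _).le).trans
    (hg (max a x + 1) (lt_of_le_of_lt (le_max_left a x) (lt_add_one _)))
  have hbdd : BddAbove (range fun x => g (max a x)) := ⟨0, by rintro _ ⟨x, rfl⟩; exact hle x⟩
  have hlim : Tendsto g atTop (nhds (⨆ x, g (max a x))) := by
    refine (tendsto_atTop_ciSup hmono' hbdd).congr' ?_
    filter_upwards [eventually_ge_atTop a] with x hx
    rw [max_eq_right hx]
  refine ⟨integrableOn_Ioi_deriv_of_nonneg hcont hderiv hg' hlim, ?_⟩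
  rw [integral_Ioi_of_hasDerivAt_of_nonneg hcont hderiv hg' hlim]
  have := ciSup_le hle
  linarith

/-- The weighted integral of `e_λ` is at most `1 / (λ - 2 m r₀)`, by comparison with the derivative
of `-(1 + x ^ m) e^{-λR(x)}`. -/
lemma elam_weighted_integral {m r₀ lam : ℝ} {r R Q : ℝ → ℝ}
    (hm : 1 ≤ m) (hr₀ : 0 < r₀)
    (hr_cont : ContinuousOn r (Ioi 0))
    (hr_pos : ∀ x, 0 < x → 0 < r x)
    (hr_bound : ∀ x, 0 < x → r x ≤ r₀ * (1 + x))
    (hr_int : IntegrableOn (fun s => 1 / r s) (Ioo 0 1))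
    (hR : ∀ x, 0 < x → R x = ∫ s in Ioo (0:ℝ) x, 1 / r s)
    (hQ_nonneg : ∀ x, 0 < x → 0 ≤ Q x)
    (helam : AEStronglyMeasurable (elam r R Q lam) (volume.restrict (Ioi 0)))
    (hlam : 2 * m * r₀ < lam) :
    IntegrableOn (fun x => elam r R Q lam x * (1 + x ^ m)) (Ioi 0) ∧
      ∫ x in Ioi 0, elam r R Q lam x * (1 + x ^ m) ≤ 1 / (lam - 2 * m * r₀) := by
  have hint := integrableOn_one_div_Ioo hr_cont hr_pos hr_int
  have hII : ∀ x, 0 ≤ x → IntervalIntegrable (fun s => 1 / r s) volume 0 x := fun x hx =>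
    (intervalIntegrable_iff_integrableOn_Ioo_of_le hx).2 (hint x)
  have hRP : ∀ x, 0 < x → R x = ∫ s in (0:ℝ)..x, 1 / r s := fun x hx => by
    rw [hR x hx, intervalIntegral.integral_of_le hx.le, integral_Ioc_eq_integral_Ioo]
  set P : ℝ → ℝ := fun x => ∫ s in (0:ℝ)..x, 1 / r s with hP
  have hinv : ContinuousOn (fun s => 1 / r s) (Ioi 0) :=
    continuousOn_const.div hr_cont fun s hs => (hr_pos s hs).ne'
  have hPderiv : ∀ x, 0 < x → HasDerivAt P (1 / r x) x := fun x hx =>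
    intervalIntegral.integral_hasDerivAt_right (hII x hx.le)
      (hinv.stronglyMeasurableAtFilter isOpen_Ioi x hx)
      (hinv.continuousAt (Ioi_mem_nhds hx))
  have hPcont : ContinuousWithinAt P (Ici 0) 0 := by
    have h := intervalIntegral.continuousOn_primitive_interval
      (f := fun s => 1 / r s) (μ := volume) (a := 0) (b := 1)
      (by rw [uIcc_of_le zero_le_one]; rwa [integrableOn_Icc_iff_integrableOn_Ioo])
    rw [uIcc_of_le zero_le_one] at h
    exact (h 0 ⟨le_rfl, zero_le_one⟩).mono_of_mem_nhdsWithin (Icc_mem_nhdsGE one_pos)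
  have hP0 : P 0 = 0 := by simp [hP]
  have hm0 : m ≠ 0 := by linarith
  have hω : 0 < lam - 2 * m * r₀ := by linarith
  obtain ⟨hgi, hgb⟩ := integral_Ioi_deriv_le_of_nonpos (a := 0)
    (g := fun x => -((1 + x ^ m) * Real.exp (-(lam * P x))))
    (g' := fun x => (lam * (1 + x ^ m) / r x - m * x ^ (m - 1)) * Real.exp (-(lam * P x)))
    (by
      have hw : ContinuousWithinAt (fun x : ℝ => 1 + x ^ m) (Ici 0) 0 :=
        (continuousAt_const.add
          (Real.continuousAt_rpow_const 0 m (Or.inr (by linarith)))).continuousWithinAt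
      exact (hw.mul (continuousWithinAt_const.mul hPcont).neg.rexp).neg)
    (by
      intro x hx
      have h1 : HasDerivAt (fun x : ℝ => 1 + x ^ m) (m * x ^ (m - 1)) x :=
        (Real.hasDerivAt_rpow_const (Or.inl (ne_of_gt hx))).const_add 1
      have h2 : HasDerivAt (fun x => Real.exp (-(lam * P x)))
          (Real.exp (-(lam * P x)) * -(lam * (1 / r x))) x :=
        ((hPderiv x hx).const_mul lam).neg.exp
      refine HasDerivAt.congr_deriv (h1.mul h2).neg ?_
      ring)
    (by
      intro x hx
      have hrx := hr_pos x hx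
      refine mul_nonneg ?_ (Real.exp_nonneg _)
      rw [sub_nonneg, le_div_iff₀ hrx]
      refine (rpow_weight_growth hm hr₀ hx (hr_bound x hx)).trans ?_
      have := Real.rpow_nonneg (le_of_lt hx) m
      gcongr)
    (by
      intro x hx
      have := Real.rpow_nonneg (le_of_lt hx) m
      have : 0 ≤ (1 + x ^ m) * Real.exp (-(lam * P x)) := by positivity
      simpa using this)
  simp only [hP0, Real.zero_rpow hm0, mul_zero, neg_zero, Real.exp_zero, add_zero, mul_one,
    neg_neg] at hgb
  have hle : ∀ x, 0 < x → elam r R Q lam x * (1 + x ^ m) ≤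
      (lam - 2 * m * r₀)⁻¹ * ((lam * (1 + x ^ m) / r x - m * x ^ (m - 1)) *
        Real.exp (-(lam * P x))) := by
    intro x hx
    have hrx := hr_pos x hx
    have hw := Real.rpow_nonneg hx.le m
    rw [le_inv_mul_iff₀ hω]
    have hexp : Real.exp (-(lam * R x) - Q x) ≤ Real.exp (-(lam * P x)) := by
      rw [hRP x hx]
      exact Real.exp_le_exp.2 (by have := hQ_nonneg x hx; linarith)
    have hgrow : (lam - 2 * m * r₀) * (1 + x ^ m) / r x ≤
        lam * (1 + x ^ m) / r x - m * x ^ (m - 1) := by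
      rw [div_le_iff₀ hrx, sub_mul (_ / _), div_mul_cancel₀ _ hrx.ne']
      linarith [rpow_weight_growth hm hr₀ hx (hr_bound x hx)]
    calc (lam - 2 * m * r₀) * (elam r R Q lam x * (1 + x ^ m))
        = (lam - 2 * m * r₀) * (1 + x ^ m) / r x * Real.exp (-(lam * R x) - Q x) := by
          unfold elam; ring
      _ ≤ (lam - 2 * m * r₀) * (1 + x ^ m) / r x * Real.exp (-(lam * P x)) := by gcongr
      _ ≤ _ := by gcongr
  have hI : IntegrableOn (fun x => elam r R Q lam x * (1 + x ^ m)) (Ioi 0) := by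
    refine (hgi.const_mul (lam - 2 * m * r₀)⁻¹).mono' (helam.mul ?_) ?_
    · exact (by fun_prop : Measurable fun x : ℝ => 1 + x ^ m).aestronglyMeasurable
    · refine (ae_restrict_iff' measurableSet_Ioi).2 (Eventually.of_forall fun x hx => ?_)
      have hw := Real.rpow_nonneg (le_of_lt hx) m
      have he : 0 ≤ elam r R Q lam x := div_nonneg (Real.exp_nonneg _) (hr_pos x hx).le
      rw [Real.norm_of_nonneg (by positivity)]
      exact hle x hx
  refine ⟨hI, ?_⟩
  calc ∫ x in Ioi 0, elam r R Q lam x * (1 + x ^ m)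
      ≤ ∫ x in Ioi 0, (lam - 2 * m * r₀)⁻¹ * ((lam * (1 + x ^ m) / r x - m * x ^ (m - 1)) *
          Real.exp (-(lam * P x))) :=
        setIntegral_mono_on hI (hgi.const_mul _) measurableSet_Ioi hle
    _ ≤ (lam - 2 * m * r₀)⁻¹ * 1 := by
        rw [integral_const_mul]
        exact mul_le_mul_of_nonneg_left hgb (inv_nonneg.2 hω.le)
    _ = 1 / (lam - 2 * m * r₀) := by rw [mul_one, one_div]

/-- Properties of `e_λ` and of the rank-one operator
`E_λ f = e_λ ⟨β,f⟩/(1-⟨β,e_λ⟩)` on `X_m`, for `λ > ω_{r,m} + β_m`. -/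
theorem Elam_bounds (m r₀ betam lam : ℝ) (r a β R Q : ℝ → ℝ)
    (hm : 1 ≤ m) (hr₀ : 0 < r₀)
    (hr_cont : ContinuousOn r (Ioi 0))
    (hr_pos : ∀ x, 0 < x → 0 < r x)
    (hr_bound : ∀ x, 0 < x → r x ≤ r₀ * (1 + x))
    (hr_int : IntegrableOn (fun s => 1 / r s) (Ioo 0 1))
    (ha_meas : Measurable a)
    (ha_nonneg : ∀ x, 0 < x → 0 ≤ a x)
    (ha_locbdd : ∀ c, 0 < c → ∃ M, ∀ x ∈ Ioc (0:ℝ) c, a x ≤ M)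
    (hβ_meas : Measurable β)
    (hβ_nonneg : ∀ x, 0 < x → 0 ≤ β x)
    (hβm : 0 ≤ betam)
    (hβ_bound : ∀ᵐ x ∂volume.restrict (Ioi 0), β x ≤ betam * (1 + x ^ m))
    (hR : ∀ x, 0 < x → R x = ∫ s in Ioo (0:ℝ) x, 1 / r s)
    (hQ : ∀ x, 0 < x → Q x = ∫ s in Ioo (0:ℝ) x, a s / r s)
    (hlam : 2 * m * r₀ + betam < lam) :
    -- (i)  ∫₀^∞ e_λ(x)(1+x^m) dx ≤ 1/(λ - ω_{r,m})
    (IntegrableOn (fun x => elam r R Q lam x * (1 + x ^ m)) (Ioi 0) ∧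
      ∫ x in Ioi 0, elam r R Q lam x * (1 + x ^ m) ≤ 1 / (lam - 2 * m * r₀)) ∧
    -- (ii)  ∫₀^∞ β e_λ ≤ β_m/(λ - ω_{r,m}) < 1
    (IntegrableOn (fun x => β x * elam r R Q lam x) (Ioi 0) ∧
      (∫ x in Ioi 0, β x * elam r R Q lam x) ≤ betam / (lam - 2 * m * r₀) ∧
      betam / (lam - 2 * m * r₀) < 1) ∧
    -- (iii)  E_λ f ∈ X_m  with  ‖E_λ f‖_m ≤ β_m/(λ-ω_{r,m}-β_m) ‖f‖_m
    (∀ f : ℝ → ℝ, IntegrableOn (fun x => f x * (1 + x ^ m)) (Ioi 0) →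
      IntegrableOn
        (fun x => elam r R Q lam x *
          ((∫ y in Ioi 0, β y * f y) /
            (1 - ∫ y in Ioi 0, β y * elam r R Q lam y)) * (1 + x ^ m)) (Ioi 0) ∧
      ∫ x in Ioi 0,
          |elam r R Q lam x *
            ((∫ y in Ioi 0, β y * f y) /
              (1 - ∫ y in Ioi 0, β y * elam r R Q lam y))| * (1 + x ^ m)
        ≤ betam / (lam - 2 * m * r₀ - betam) * ∫ x in Ioi 0, |f x| * (1 + x ^ m)) := by
  have hpos_ae : ∀ᵐ x ∂volume.restrict (Ioi (0:ℝ)), 0 < x := ae_restrict_mem measurableSet_Ioi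
  have hr_intg := integrableOn_one_div_Ioo hr_cont hr_pos hr_int
  have hr_meas : AEStronglyMeasurable r (volume.restrict (Ioi 0)) :=
    hr_cont.aestronglyMeasurable measurableSet_Ioi
  have har_nonneg : ∀ x, 0 < x → 0 ≤ a x / r x := fun x hx =>
    div_nonneg (ha_nonneg x hx) (hr_pos x hx).le
  have har_int : ∀ x, 0 < x → IntegrableOn (fun s => a s / r s) (Ioo 0 x) := by
    intro x hx
    obtain ⟨M, hM⟩ := ha_locbdd x hx
    refine ((hr_intg x).const_mul M).mono' ?_ ?_
    · exact (ha_meas.aemeasurable.div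
        (hr_meas.mono_measure
          (Measure.restrict_mono Ioo_subset_Ioi_self le_rfl)).aemeasurable).aestronglyMeasurable
    · refine (ae_restrict_iff' measurableSet_Ioo).2 (Eventually.of_forall fun s hs => ?_)
      rw [Real.norm_of_nonneg (har_nonneg s hs.1), mul_one_div]
      exact div_le_div_of_nonneg_right (hM s ⟨hs.1, hs.2.le⟩) (hr_pos s hs.1).le
  have hQ_nonneg : ∀ x, 0 < x → 0 ≤ Q x := fun x hx => by
    rw [hQ x hx]
    exact setIntegral_nonneg measurableSet_Ioo fun s hs => har_nonneg s hs.1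
  have hR_meas := aemeasurable_setIntegral_Ioo
    (fun x hx => (one_div_pos.2 (hr_pos x hx)).le) (fun x _ => hr_intg x) hR
  have hQ_meas := aemeasurable_setIntegral_Ioo har_nonneg har_int hQ
  have helam : AEStronglyMeasurable (elam r R Q lam) (volume.restrict (Ioi 0)) :=
    ((((hR_meas.const_mul lam).neg.sub hQ_meas).exp).div
      hr_meas.aemeasurable).aestronglyMeasurable
  have he_nonneg : ∀ x, 0 < x → 0 ≤ elam r R Q lam x := fun x hx =>
    div_nonneg (Real.exp_nonneg _) (hr_pos x hx).le
  have hω : 0 < lam - 2 * m * r₀ := by linarith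
  have hωβ : 0 < lam - 2 * m * r₀ - betam := by linarith
  obtain ⟨hI, hIle⟩ := elam_weighted_integral (lam := lam) hm hr₀ hr_cont hr_pos hr_bound hr_int
    hR hQ_nonneg helam (by linarith)
  have hβe_le : ∀ᵐ x ∂volume.restrict (Ioi 0),
      β x * elam r R Q lam x ≤ betam * (elam r R Q lam x * (1 + x ^ m)) := by
    filter_upwards [hpos_ae, hβ_bound] with x hx hb
    nlinarith [he_nonneg x hx]
  have hβe : IntegrableOn (fun x => β x * elam r R Q lam x) (Ioi 0) := by
    refine (hI.const_mul betam).mono' (hβ_meas.aestronglyMeasurable.mul helam) ?_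
    filter_upwards [hpos_ae, hβe_le] with x hx hle
    rwa [Real.norm_of_nonneg (mul_nonneg (hβ_nonneg x hx) (he_nonneg x hx))]
  have hβe_int : (∫ x in Ioi 0, β x * elam r R Q lam x) ≤ betam / (lam - 2 * m * r₀) :=
    calc (∫ x in Ioi 0, β x * elam r R Q lam x)
        ≤ ∫ x in Ioi 0, betam * (elam r R Q lam x * (1 + x ^ m)) :=
          integral_mono_ae hβe (hI.const_mul betam) hβe_le
      _ ≤ betam * (1 / (lam - 2 * m * r₀)) := by
          rw [integral_const_mul]
          exact mul_le_mul_of_nonneg_left hIle hβm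
      _ = betam / (lam - 2 * m * r₀) := by rw [mul_one_div]
  refine ⟨⟨hI, hIle⟩, ⟨hβe, hβe_int, (div_lt_one hω).2 (by linarith)⟩, fun f hf => ?_⟩
  set b := ∫ y in Ioi 0, β y * elam r R Q lam y
  set F := ∫ x in Ioi 0, |f x| * (1 + x ^ m) with hF
  set N := ∫ y in Ioi 0, β y * f y
  have hfw : IntegrableOn (fun x => |f x| * (1 + x ^ m)) (Ioi 0) := by
    refine hf.norm.congr ?_
    filter_upwards [hpos_ae] with x hx
    have := Real.rpow_nonneg hx.le m
    rw [Real.norm_eq_abs, abs_mul, abs_of_nonneg (by positivity : 0 ≤ 1 + x ^ m)]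
  have hN : |N| ≤ betam * F := by
    rw [hF, ← integral_const_mul, ← Real.norm_eq_abs]
    refine norm_integral_le_of_norm_le (hfw.const_mul betam) ?_
    filter_upwards [hpos_ae, hβ_bound] with x hx hb
    rw [Real.norm_eq_abs, abs_mul, abs_of_nonneg (hβ_nonneg x hx)]
    nlinarith [abs_nonneg (f x)]
  have hb : (lam - 2 * m * r₀ - betam) / (lam - 2 * m * r₀) ≤ 1 - b := by
    rw [sub_div, div_self hω.ne']
    linarith
  have hb_pos : 0 < 1 - b := (div_pos hωβ hω).trans_le hb
  have hc : |N / (1 - b)| ≤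
      betam * F / ((lam - 2 * m * r₀ - betam) / (lam - 2 * m * r₀)) := by
    rw [abs_div, abs_of_pos hb_pos]
    have := div_pos hωβ hω
    exact div_le_div₀ ((abs_nonneg N).trans hN) hN this hb
  have hcongr : ∫ x in Ioi 0, |elam r R Q lam x * (N / (1 - b))| * (1 + x ^ m) =
      ∫ x in Ioi 0, |N / (1 - b)| * (elam r R Q lam x * (1 + x ^ m)) := by
    refine setIntegral_congr_fun measurableSet_Ioi fun x hx => ?_
    simp only [abs_mul, abs_of_nonneg (he_nonneg x hx)]
    ring
  refine ⟨(hI.mul_const (N / (1 - b))).congr (Eventually.of_forall fun x => by ring), ?_⟩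
  rw [hcongr, integral_const_mul]
  calc |N / (1 - b)| * ∫ x in Ioi 0, elam r R Q lam x * (1 + x ^ m)
      ≤ betam * F / ((lam - 2 * m * r₀ - betam) / (lam - 2 * m * r₀)) *
          (1 / (lam - 2 * m * r₀)) :=
        mul_le_mul hc hIle (setIntegral_nonneg measurableSet_Ioi fun x hx =>
          mul_nonneg (he_nonneg x hx) (by have := Real.rpow_nonneg (le_of_lt hx) m; positivity))
          ((abs_nonneg _).trans hc)
    _ = betam / (lam - 2 * m * r₀ - betam) * F := by
        field_simp
end

section
/- Let m ≥ 1 and λ > 2m r₀. For f ∈ X_m define u(x) = (e^{−λR(x)−Q(x)}/r(x)) ∫₀^x f(y) e^{λR(y)+Q(y)} dy. Then u ∈ X_m, a·u ∈ X_m, ru is locally absolutely continuous with (ru)' ∈ X_m, the equation λ u(x) + (ru)'(x) + a(x)u(x) = f(x) holds for a.e. x > 0, lim_{x→0⁺} r(x)u(x) = 0, and ‖u‖_m ≤ ‖f‖_m/(λ − 2m r₀). -/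
open MeasureTheory Set Filter

/-- The resolvent `R(λ,Z_{0,m})f` of the transport–absorption operator with homogeneous
boundary condition:
`u(x) = (e^{-λR(x)-Q(x)}/r(x)) ∫₀^x f(y) e^{λR(y)+Q(y)} dy`. -/
noncomputable def res0 (r R Q f : ℝ → ℝ) (lam x : ℝ) : ℝ :=
  Real.exp (-(lam * R x) - Q x) / r x *
    ∫ y in Set.Ioo (0:ℝ) x, f y * Real.exp (lam * R y + Q y)

theorem AbsolutelyContinuousOnInterval.comp_contDiff {φ G : ℝ → ℝ} {a b : ℝ}
    (hφ : ContDiff ℝ 1 φ) (hG : AbsolutelyContinuousOnInterval G a b) :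
    AbsolutelyContinuousOnInterval (fun x => φ (G x)) a b := by
  obtain ⟨C, hC⟩ := hG.exists_bound
  obtain ⟨K, hK⟩ := hφ.contDiffOn.exists_lipschitzOnWith (by decide)
    (convex_closedBall (0 : ℝ) C) (isCompact_closedBall 0 C)
  have hlim : Tendsto (fun E : ℕ × (ℕ → ℝ × ℝ) =>
      (K : ℝ) * ∑ i ∈ Finset.range E.1, dist (G (E.2 i).1) (G (E.2 i).2))
      (AbsolutelyContinuousOnInterval.totalLengthFilter ⊓
        Filter.principal (AbsolutelyContinuousOnInterval.disjWithin a b)) (nhds 0) := by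
    simpa using Tendsto.const_mul (K : ℝ) hG
  refine squeeze_zero' (Eventually.of_forall fun E => ?_) ?_ hlim
  · exact Finset.sum_nonneg fun i _ => dist_nonneg
  · filter_upwards [mem_inf_of_right (mem_principal_self _)] with E hE
    rw [Finset.mul_sum]
    refine Finset.sum_le_sum fun i hi => hK.dist_le_mul _ ?_ _ ?_
    · simpa using hC _ (hE.1 i hi).1
    · simpa using hC _ (hE.1 i hi).2

theorem MeasureTheory.LocallyIntegrable.intervalIntegrable {g : ℝ → ℝ}
    (hg : LocallyIntegrable g) (a b : ℝ) :
    IntervalIntegrable g volume a b :=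
  (hg.integrableOn_isCompact isCompact_uIcc).intervalIntegrable

theorem MeasureTheory.LocallyIntegrable.absolutelyContinuousOnInterval_primitive {g : ℝ → ℝ}
    (hg : LocallyIntegrable g) {a b : ℝ} (ha : 0 ≤ a) (hab : a ≤ b) :
    AbsolutelyContinuousOnInterval (fun x => ∫ t in (0:ℝ)..x, g t) a b := by
  refine ((hg.intervalIntegrable 0 b).absolutelyContinuousOnInterval_intervalIntegral
    (c := 0) (by simp)).mono ?_
  rw [uIcc_of_le hab, uIcc_of_le (ha.trans hab)]
  exact Icc_subset_Icc_left ha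

/-- The fundamental theorem of calculus for the product of `exp (-∫₀ˣ g)` and an absolutely
continuous function. -/
theorem integral_exp_neg_primitive_mul {g F F' : ℝ → ℝ} (hg : LocallyIntegrable g) {a b : ℝ}
    (ha : 0 ≤ a) (hab : a ≤ b) (hF : AbsolutelyContinuousOnInterval F a b)
    (hF' : ∀ᵐ x, x ∈ uIcc a b → HasDerivAt F (F' x) x) :
    ∫ x in a..b, Real.exp (-∫ t in (0:ℝ)..x, g t) * (F' x - g x * F x) =
      Real.exp (-∫ t in (0:ℝ)..b, g t) * F b - Real.exp (-∫ t in (0:ℝ)..a, g t) * F a := by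
  have hE := AbsolutelyContinuousOnInterval.comp_contDiff
    (φ := fun y => Real.exp (-y)) (by fun_prop)
    (hg.absolutelyContinuousOnInterval_primitive ha hab)
  rw [← hE.integral_deriv_mul_eq_sub hF]
  refine intervalIntegral.integral_congr_ae ?_
  filter_upwards [hF', LocallyIntegrable.ae_hasDerivAt_integral hg] with x hx hgx hxab
  rw [(hx (uIoc_subset_uIcc hxab)).deriv, (hgx 0).fun_neg.exp.deriv]
  ring

theorem lintegral_Ioi_le_of_forall_Ioc {p : ℝ → ENNReal} (hp : Measurable p) {y : ℝ} {C : ENNReal}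
    (h : ∀ T, y ≤ T → ∫⁻ x in Ioc y T, p x ≤ C) : ∫⁻ x in Ioi y, p x ≤ C := by
  have ht := (aecover_Iic (μ := volume.restrict (Ioi y)) (b := fun T : ℝ => T)
    tendsto_id).lintegral_tendsto_of_countably_generated hp.aemeasurable
  refine le_of_tendsto ht ?_
  filter_upwards [eventually_ge_atTop y] with T hT
  rw [Measure.restrict_restrict measurableSet_Iic, inter_comm, Ioi_inter_Iic]
  exact h T hT

theorem mul_rpow_sub_one_le {m x : ℝ} (hm : 1 ≤ m) (hx : 0 < x) :
    (1 + x) * (m * x ^ (m - 1)) ≤ 2 * m * (1 + x ^ m) := by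
  have h1 : x * x ^ (m - 1) = x ^ m := by
    rw [mul_comm, ← Real.rpow_add_one hx.ne']; ring_nf
  have h2 : x ^ (m - 1) ≤ 1 + x ^ m := by
    have := Real.rpow_nonneg hx.le m
    rcases le_total x 1 with h | h
    · have := Real.rpow_le_one hx.le h (by linarith : 0 ≤ m - 1)
      linarith
    · have := Real.rpow_le_rpow_of_exponent_le h (by linarith : m - 1 ≤ m)
      linarith
  have h3 : (1 + x) * (m * x ^ (m - 1)) = m * (x ^ (m - 1) + x ^ m) := by rw [← h1]; ring
  rw [h3]
  nlinarith

/-- The weight `1 + x ^ m` is a supersolution of the adjoint problem, so the adjoint kernel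
integrates to at most the weight. -/
theorem lintegral_weight_le {m r₀ lam : ℝ} {ρ a : ℝ → ℝ} (hm : 1 ≤ m)
    (hρ_meas : Measurable ρ) (ha_meas : Measurable a)
    (hρ : ∀ x, 0 < x → 0 ≤ ρ x)
    (hρ_bound : ∀ x, 0 < x → 1 ≤ r₀ * (1 + x) * ρ x) (hr₀ : 0 < r₀)
    (ha_nonneg : ∀ x, 0 < x → 0 ≤ a x) (hlam : 2 * m * r₀ < lam)
    (hg : LocallyIntegrable fun s => (lam + a s) * ρ s) {y : ℝ} (hy : 0 < y) :
    ∫⁻ x in Ioi y, ENNReal.ofReal ((lam - 2 * m * r₀ + a x) * ρ x * (1 + x ^ m) *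
        Real.exp (-∫ t in (0:ℝ)..x, (lam + a t) * ρ t)) ≤
      ENNReal.ofReal ((1 + y ^ m) * Real.exp (-∫ t in (0:ℝ)..y, (lam + a t) * ρ t)) := by
  set g : ℝ → ℝ := fun s => (lam + a s) * ρ s with hgdef
  have hGc : Continuous fun x => ∫ t in (0:ℝ)..x, g t :=
    intervalIntegral.continuous_primitive hg.intervalIntegrable 0
  refine lintegral_Ioi_le_of_forall_Ioc ?_ fun T hT => ?_
  · have := hGc.measurable
    fun_prop
  have hpos : ∀ x ∈ uIcc y T, 0 < x := fun x hx => by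
    rw [uIcc_of_le hT] at hx
    exact hy.trans_le hx.1
  have hwd : ∀ x, 0 < x → HasDerivAt (fun x : ℝ => 1 + x ^ m) (m * x ^ (m - 1)) x := fun x hx =>
    (Real.hasDerivAt_rpow_const (Or.inl hx.ne')).const_add 1
  have hcd : ContDiffOn ℝ 1 (fun x : ℝ => 1 + x ^ m) (uIcc y T) := fun x hx =>
    (contDiffAt_const.add (Real.contDiffAt_rpow_const_of_ne (hpos x hx).ne')).contDiffWithinAt
  have hwc : ContinuousOn (fun x : ℝ => 1 + x ^ m) (uIcc y T) := hcd.continuousOn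
  have hwc' : ContinuousOn (fun x : ℝ => m * x ^ (m - 1)) (uIcc y T) := fun x hx =>
    (continuousAt_const.mul (Real.continuousAt_rpow_const _ _
      (Or.inl (hpos x hx).ne'))).continuousWithinAt
  have hftc := integral_exp_neg_primitive_mul hg hy.le hT hcd.absolutelyContinuousOnInterval
    (Eventually.of_forall fun x hx => hwd x (hpos x hx))
  have hEc : Continuous fun x => Real.exp (-∫ t in (0:ℝ)..x, g t) := by fun_prop
  have hint : IntervalIntegrable (fun x => Real.exp (-∫ t in (0:ℝ)..x, g t) *
      (m * x ^ (m - 1) - g x * (1 + x ^ m))) volume y T :=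
    (hwc'.intervalIntegrable.sub ((hg.intervalIntegrable y T).mul_continuousOn hwc)).continuousOn_mul
      hEc.continuousOn
  have hle : ∀ x, 0 < x → (lam - 2 * m * r₀ + a x) * ρ x * (1 + x ^ m) *
      Real.exp (-∫ t in (0:ℝ)..x, g t) ≤ -(Real.exp (-∫ t in (0:ℝ)..x, g t) *
      (m * x ^ (m - 1) - g x * (1 + x ^ m))) := fun x hx => by
    have hd := Real.rpow_nonneg hx.le (m - 1)
    have h1 : m * x ^ (m - 1) ≤ 2 * m * r₀ * ρ x * (1 + x ^ m) := calc
      m * x ^ (m - 1) ≤ (r₀ * (1 + x) * ρ x) * (m * x ^ (m - 1)) :=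
        le_mul_of_one_le_left (by positivity) (hρ_bound x hx)
      _ = (r₀ * ρ x) * ((1 + x) * (m * x ^ (m - 1))) := by ring
      _ ≤ (r₀ * ρ x) * (2 * m * (1 + x ^ m)) := by
        have := hρ x hx
        exact mul_le_mul_of_nonneg_left (mul_rpow_sub_one_le hm hx) (by positivity)
      _ = _ := by ring
    have h2 := mul_le_mul_of_nonneg_left h1 (Real.exp_pos (-∫ t in (0:ℝ)..x, g t)).le
    simp only [hgdef] at h2 ⊢
    linear_combination h2
  have hnn : ∀ x, 0 < x → 0 ≤ (lam - 2 * m * r₀ + a x) * ρ x * (1 + x ^ m) *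
      Real.exp (-∫ t in (0:ℝ)..x, g t) := fun x hx => by
    have := Real.rpow_nonneg hx.le m
    have := hρ x hx
    have := ha_nonneg x hx
    have : 0 ≤ lam - 2 * m * r₀ := by linarith
    positivity
  have hmem : ∀ᵐ x ∂volume.restrict (Ioc y T), 0 < x := by
    filter_upwards [ae_restrict_mem measurableSet_Ioc] with x hx using hy.trans hx.1
  calc _ ≤ ∫⁻ x in Ioc y T, ENNReal.ofReal (-(Real.exp (-∫ t in (0:ℝ)..x, g t) *
          (m * x ^ (m - 1) - g x * (1 + x ^ m)))) := by
        refine lintegral_mono_ae ?_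
        filter_upwards [hmem] with x hx using ENNReal.ofReal_le_ofReal (hle x hx)
    _ = ENNReal.ofReal (∫ x in y..T, -(Real.exp (-∫ t in (0:ℝ)..x, g t) *
          (m * x ^ (m - 1) - g x * (1 + x ^ m)))) := by
        rw [intervalIntegral.integral_of_le hT]
        refine (ofReal_integral_eq_lintegral_ofReal
          ((intervalIntegrable_iff_integrableOn_Ioc_of_le hT).1 hint.neg) ?_).symm
        filter_upwards [hmem] with x hx using (hnn x hx).trans (hle x hx)
    _ ≤ _ := by
        refine ENNReal.ofReal_le_ofReal ?_
        rw [intervalIntegral.integral_neg, hftc]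
        have := Real.rpow_nonneg (hy.le.trans hT) m
        have : 0 ≤ Real.exp (-∫ t in (0:ℝ)..T, g t) * (1 + T ^ m) := by positivity
        linarith

/-- Tonelli's theorem on the triangle `0 < y < x`, with the integral over the second variable
controlled. -/
theorem lintegral_triangle_le {p q C : ℝ → ENNReal} (hp : Measurable p) (hq : Measurable q)
    (hpC : ∀ y, 0 < y → ∫⁻ x in Ioi y, p x ≤ C y) :
    ∫⁻ x in Ioi (0:ℝ), p x * ∫⁻ y in Ioo 0 x, q y ≤ ∫⁻ y in Ioi (0:ℝ), q y * C y := by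
  have hmeas : Measurable (Function.uncurry fun x y : ℝ => p x * (Iio x).indicator q y) := by
    have h1 : MeasurableSet {z : ℝ × ℝ | z.2 < z.1} :=
      measurableSet_lt measurable_snd measurable_fst
    have h2 := (hq.comp measurable_snd).indicator h1
    exact (hp.comp measurable_fst).mul h2
  calc _ = ∫⁻ x in Ioi (0:ℝ), ∫⁻ y in Ioi (0:ℝ), p x * (Iio x).indicator q y := by
        refine lintegral_congr fun x => ?_
        rw [lintegral_const_mul _ (hq.indicator measurableSet_Iio),
          lintegral_indicator measurableSet_Iio, Measure.restrict_restrict measurableSet_Iio,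
          inter_comm, Ioi_inter_Iio]
    _ = ∫⁻ y in Ioi (0:ℝ), ∫⁻ x in Ioi (0:ℝ), p x * (Iio x).indicator q y :=
        lintegral_lintegral_swap hmeas.aemeasurable
    _ ≤ _ := by
        refine lintegral_mono_ae ?_
        filter_upwards [ae_restrict_mem measurableSet_Ioi] with y (hy : 0 < y)
        have : ∀ x, p x * (Iio x).indicator q y = q y * (Ioi y).indicator p x := fun x => by
          by_cases h : y < x <;> simp [h, mul_comm]
        simp only [this]
        rw [lintegral_const_mul _ (hp.indicator measurableSet_Ioi),
          lintegral_indicator measurableSet_Ioi, Measure.restrict_restrict measurableSet_Ioi,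
          Ioi_inter_Ioi, sup_of_le_left hy.le]
        gcongr
        exact hpC y hy

theorem locallyIntegrable_indicator_Ioi {g : ℝ → ℝ}
    (hg : ∀ T, 0 < T → IntegrableOn g (Ioc 0 T)) :
    LocallyIntegrable ((Ioi (0:ℝ)).indicator g) := by
  refine locallyIntegrable_iff.2 fun K hK => ?_
  obtain ⟨T, hT⟩ := hK.bddAbove
  rw [integrableOn_indicator_iff measurableSet_Ioi]
  refine (hg (max T 1) (by positivity)).mono_set fun x hx => ⟨hx.1, ?_⟩
  exact (hT hx.2).trans (le_max_left _ _)

/-- For `λ > 2 m r₀` and `f ∈ X_m`, the function `u = R(λ,Z_{0,m})f` satisfies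
`u ∈ X_m`, `a u ∈ X_m`, `ru` is locally absolutely continuous with `(ru)' ∈ X_m`,
`λu + (ru)' + au = f` a.e., `lim_{x→0⁺} r(x)u(x) = 0`, and `‖u‖_m ≤ ‖f‖_m/(λ - 2 m r₀)`. -/
theorem resolvent_Z0 (m r₀ lam : ℝ) (r a R Q f : ℝ → ℝ)
    (hm : 1 ≤ m) (hr₀ : 0 < r₀)
    (hr_cont : ContinuousOn r (Ioi 0))
    (hr_pos : ∀ x, 0 < x → 0 < r x)
    (hr_bound : ∀ x, 0 < x → r x ≤ r₀ * (1 + x))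
    (hr_int : IntegrableOn (fun s => 1 / r s) (Ioo 0 1))
    (ha_meas : Measurable a)
    (ha_nonneg : ∀ x, 0 < x → 0 ≤ a x)
    (ha_locbdd : ∀ c, 0 < c → ∃ M, ∀ x ∈ Ioc (0:ℝ) c, a x ≤ M)
    (hR : ∀ x, 0 < x → R x = ∫ s in Ioo (0:ℝ) x, 1 / r s)
    (hQ : ∀ x, 0 < x → Q x = ∫ s in Ioo (0:ℝ) x, a s / r s)
    (hlam : 2 * m * r₀ < lam)
    (hf_meas : Measurable f)
    (hf_int : IntegrableOn (fun x => f x * (1 + x ^ m)) (Ioi 0)) :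
    -- u ∈ X_m
    IntegrableOn (fun x => res0 r R Q f lam x * (1 + x ^ m)) (Ioi 0) ∧
    -- a·u ∈ X_m
    IntegrableOn (fun x => a x * res0 r R Q f lam x * (1 + x ^ m)) (Ioi 0) ∧
    -- ru is locally absolutely continuous and λu + (ru)' + au = f holds a.e.
    (∀ x₀ x₁ : ℝ, 0 < x₀ → x₀ ≤ x₁ →
      r x₁ * res0 r R Q f lam x₁ - r x₀ * res0 r R Q f lam x₀ =
        ∫ s in x₀..x₁, (f s - lam * res0 r R Q f lam s - a s * res0 r R Q f lam s)) ∧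
    -- homogeneous boundary condition
    Tendsto (fun x => r x * res0 r R Q f lam x) (nhdsWithin 0 (Ioi 0)) (nhds 0) ∧
    -- resolvent estimate
    ∫ x in Ioi 0, |res0 r R Q f lam x| * (1 + x ^ m)
      ≤ (∫ x in Ioi 0, |f x| * (1 + x ^ m)) / (lam - 2 * m * r₀) := by
  have hlam' : 0 < lam - 2 * m * r₀ := by linarith
  set ρ : ℝ → ℝ := (Ioi (0:ℝ)).indicator (fun s => 1 / r s) with hρdef
  have hρ_eq : ∀ x, 0 < x → ρ x = 1 / r x := fun x hx => indicator_of_mem (mem_Ioi.2 hx) _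
  have hrinv : ContinuousOn (fun s => 1 / r s) (Ioi 0) :=
    continuousOn_const.div hr_cont fun x hx => (hr_pos x hx).ne'
  have hρ_meas : Measurable ρ := by
    classical
    rw [hρdef, ← piecewise_eq_indicator]
    exact hrinv.measurable_piecewise continuousOn_const measurableSet_Ioi
  have hρ_nonneg : ∀ x, 0 ≤ ρ x := fun x =>
    indicator_nonneg (fun x hx => (one_div_pos.2 (hr_pos x hx)).le) x
  have hρ_bound : ∀ x, 0 < x → 1 ≤ r₀ * (1 + x) * ρ x := fun x hx => by
    rw [hρ_eq x hx, mul_one_div, le_div_iff₀ (hr_pos x hx), one_mul]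
    exact hr_bound x hx
  have hrinv_int : ∀ T, 0 < T → IntegrableOn (fun s => 1 / r s) (Ioc 0 T) := fun T hT => by
    have h1 : IntegrableOn (fun s => 1 / r s) (Ioc 0 1) :=
      integrableOn_Ioc_iff_integrableOn_Ioo (by simp) |>.2 hr_int
    have h2 : IntegrableOn (fun s => 1 / r s) (Icc 1 T) :=
      (hrinv.mono fun x hx => lt_of_lt_of_le one_pos hx.1).integrableOn_Icc
    refine (h1.union h2).mono_set fun x hx => ?_
    rcases le_total x 1 with h | h
    · exact Or.inl ⟨hx.1, h⟩
    · exact Or.inr ⟨h, hx.2⟩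
  have har_int : ∀ T, 0 < T → IntegrableOn (fun s => a s / r s) (Ioc 0 T) := fun T hT => by
    obtain ⟨M, hM⟩ := ha_locbdd T hT
    have := (hrinv_int T hT).bdd_mul (c := M) ha_meas.aestronglyMeasurable (by
      filter_upwards [ae_restrict_mem measurableSet_Ioc] with x hx
      rw [Real.norm_of_nonneg (ha_nonneg x hx.1)]
      exact hM x hx)
    simpa only [mul_one_div, IntegrableOn] using this
  set g : ℝ → ℝ := fun s => (lam + a s) * ρ s with hgdef
  have hg : LocallyIntegrable g := by
    have : g = (Ioi (0:ℝ)).indicator (fun s => lam * (1 / r s) + a s / r s) := by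
      funext s
      by_cases hs : s ∈ Ioi (0:ℝ)
      · simp only [hgdef, hρdef, indicator_of_mem hs]; ring
      · simp only [hgdef, hρdef, indicator_of_notMem hs, mul_zero]
    rw [this]
    exact locallyIntegrable_indicator_Ioi fun T hT =>
      ((hrinv_int T hT).const_mul lam).add (har_int T hT)
  set G : ℝ → ℝ := fun x => ∫ t in (0:ℝ)..x, g t with hGdef
  have hGc : Continuous G := intervalIntegral.continuous_primitive hg.intervalIntegrable 0
  have hG_eq : ∀ x, 0 < x → lam * R x + Q x = G x := fun x hx => by
    rw [hR x hx, hQ x hx, ← integral_Ioc_eq_integral_Ioo, ← integral_Ioc_eq_integral_Ioo,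
      ← integral_const_mul, ← integral_add ((hrinv_int x hx).const_mul lam) (har_int x hx)]
    simp only [hGdef]
    rw [intervalIntegral.integral_of_le hx.le]
    refine setIntegral_congr_fun measurableSet_Ioc fun s hs => ?_
    simp only [hgdef, hρ_eq s hs.1]
    ring
  have hf_int0 : IntegrableOn f (Ioi 0) := by
    refine Integrable.mono hf_int hf_meas.aestronglyMeasurable ?_
    filter_upwards [ae_restrict_mem measurableSet_Ioi] with x (hx : 0 < x)
    have := Real.rpow_nonneg hx.le m
    rw [norm_mul, Real.norm_of_nonneg (by positivity : 0 ≤ 1 + x ^ m)]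
    exact le_mul_of_one_le_right (norm_nonneg _) (by linarith)
  set h : ℝ → ℝ := (Ioi (0:ℝ)).indicator (fun y => f y * Real.exp (G y)) with hhdef
  have hh : LocallyIntegrable h := locallyIntegrable_indicator_Ioi fun T hT =>
    (intervalIntegrable_iff_integrableOn_Ioc_of_le hT.le).1
      (((intervalIntegrable_iff_integrableOn_Ioc_of_le hT.le).2
        (hf_int0.mono_set Ioc_subset_Ioi_self)).mul_continuousOn
          (Real.continuous_exp.comp hGc).continuousOn)
  set F : ℝ → ℝ := fun x => ∫ t in (0:ℝ)..x, h t with hFdef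
  have hFc : Continuous F := intervalIntegral.continuous_primitive hh.intervalIntegrable 0
  have hF_eq : ∀ x, 0 < x → F x = ∫ y in Ioo (0:ℝ) x, f y * Real.exp (G y) := fun x hx => by
    simp only [hFdef]
    rw [intervalIntegral.integral_of_le hx.le, integral_Ioc_eq_integral_Ioo]
    exact setIntegral_congr_fun measurableSet_Ioo fun s hs => indicator_of_mem (mem_Ioi.2 hs.1) _
  have hu : ∀ x, 0 < x → res0 r R Q f lam x = Real.exp (-G x) * ρ x * F x := fun x hx => by
    have h1 : ∫ y in Ioo (0:ℝ) x, f y * Real.exp (lam * R y + Q y) = F x := by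
      rw [hF_eq x hx]
      refine setIntegral_congr_fun measurableSet_Ioo fun s hs => ?_
      simp only [hG_eq s hs.1]
    rw [res0, h1, ← hG_eq x hx, hρ_eq x hx]
    ring_nf
  have hru : ∀ x, 0 < x → r x * res0 r R Q f lam x = Real.exp (-G x) * F x := fun x hx => by
    have := (hr_pos x hx).ne'
    rw [hu x hx, hρ_eq x hx]
    field_simp
  -- the total mass of `(lam - 2 m r₀ + a) |u|`, in the weighted norm
  set v : ℝ → ℝ := fun x => (lam - 2 * m * r₀ + a x) * (1 + x ^ m) *
    |Real.exp (-G x) * ρ x * F x| with hvdef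
  have hv_meas : Measurable v := by
    have := hGc.measurable
    have := hFc.measurable
    fun_prop
  have hv_lint : ∫⁻ x in Ioi (0:ℝ), ENNReal.ofReal (v x) ≤
      ∫⁻ x in Ioi (0:ℝ), ENNReal.ofReal (|f x| * (1 + x ^ m)) := by
    have hGm := hGc.measurable
    calc _ ≤ ∫⁻ x in Ioi (0:ℝ), ENNReal.ofReal ((lam - 2 * m * r₀ + a x) * ρ x * (1 + x ^ m) *
            Real.exp (-G x)) * ∫⁻ y in Ioo 0 x, ENNReal.ofReal (|f y| * Real.exp (G y)) := by
          refine lintegral_mono_ae ?_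
          filter_upwards [ae_restrict_mem measurableSet_Ioi] with x (hx : 0 < x)
          have h1 := Real.rpow_nonneg hx.le m
          have h2 := hρ_nonneg x
          have h3 := ha_nonneg x hx
          have h4 : v x = (lam - 2 * m * r₀ + a x) * ρ x * (1 + x ^ m) *
              Real.exp (-G x) * |F x| := by
            simp only [hvdef]
            rw [abs_mul, abs_of_nonneg (by positivity : 0 ≤ Real.exp (-G x) * ρ x)]
            ring
          rw [h4, ENNReal.ofReal_mul (by positivity)]
          gcongr
          rw [← Real.norm_eq_abs, ofReal_norm, hF_eq x hx]
          refine (enorm_integral_le_lintegral_enorm _).trans (lintegral_mono fun y => ?_)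
          rw [← ofReal_norm, norm_mul, Real.norm_eq_abs, Real.norm_eq_abs, Real.abs_exp]
      _ ≤ ∫⁻ y in Ioi (0:ℝ), ENNReal.ofReal (|f y| * Real.exp (G y)) *
            ENNReal.ofReal ((1 + y ^ m) * Real.exp (-G y)) :=
          lintegral_triangle_le (by fun_prop) (by fun_prop) fun y hy =>
            lintegral_weight_le hm hρ_meas ha_meas (fun x _ => hρ_nonneg x) hρ_bound hr₀
              ha_nonneg hlam hg hy
      _ = _ := by
          refine lintegral_congr fun y => ?_
          rw [← ENNReal.ofReal_mul (by positivity), Real.exp_neg]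
          congr 1
          have := (Real.exp_pos (G y)).ne'
          field_simp
  have hfw_int : IntegrableOn (fun x => |f x| * (1 + x ^ m)) (Ioi 0) := by
    refine hf_int.norm.congr ?_
    filter_upwards [ae_restrict_mem measurableSet_Ioi] with x (hx : 0 < x)
    have := Real.rpow_nonneg hx.le m
    rw [norm_mul, Real.norm_of_nonneg (by positivity : 0 ≤ 1 + x ^ m), Real.norm_eq_abs]
  have hfw_nonneg : 0 ≤ᵐ[volume.restrict (Ioi 0)] fun x => |f x| * (1 + x ^ m) := by
    filter_upwards [ae_restrict_mem measurableSet_Ioi] with x (hx : 0 < x)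
    have := Real.rpow_nonneg hx.le m
    simp only [Pi.zero_apply]
    positivity
  have hv_nonneg : ∀ x, 0 < x → 0 ≤ v x := fun x hx => by
    have h1 := Real.rpow_nonneg hx.le m
    have h3 := ha_nonneg x hx
    simp only [hvdef]
    positivity
  have hv_nonneg' : 0 ≤ᵐ[volume.restrict (Ioi 0)] v := by
    filter_upwards [ae_restrict_mem measurableSet_Ioi] with x hx using hv_nonneg x hx
  rw [← ofReal_integral_eq_lintegral_ofReal hfw_int hfw_nonneg] at hv_lint
  have hv_int : IntegrableOn v (Ioi 0) :=
    ⟨hv_meas.aestronglyMeasurable, (hasFiniteIntegral_iff_ofReal hv_nonneg').2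
      (hv_lint.trans_lt ENNReal.ofReal_lt_top)⟩
  have hv_le : ∫ x in Ioi 0, v x ≤ ∫ x in Ioi 0, |f x| * (1 + x ^ m) := by
    rw [← ofReal_integral_eq_lintegral_ofReal hv_int hv_nonneg'] at hv_lint
    exact (ENNReal.ofReal_le_ofReal_iff (integral_nonneg_of_ae hfw_nonneg)).1 hv_lint
  have hu_meas : AEStronglyMeasurable (res0 r R Q f lam) (volume.restrict (Ioi 0)) := by
    have hGm := hGc.measurable
    have hFm := hFc.measurable
    have : Measurable fun x => Real.exp (-G x) * ρ x * F x := by fun_prop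
    refine this.aestronglyMeasurable.congr ?_
    filter_upwards [ae_restrict_mem measurableSet_Ioi] with x hx using (hu x hx).symm
  have hw_meas : Measurable fun x : ℝ => 1 + x ^ m := by fun_prop
  have hv_split : ∀ x, 0 < x → v x =
      (lam - 2 * m * r₀) * (|res0 r R Q f lam x| * (1 + x ^ m)) +
        a x * (|res0 r R Q f lam x| * (1 + x ^ m)) := fun x hx => by
    simp only [hvdef, ← hu x hx]
    ring
  have hnn : ∀ x, 0 < x → 0 ≤ |res0 r R Q f lam x| * (1 + x ^ m) := fun x hx => by
    have := Real.rpow_nonneg hx.le m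
    positivity
  have hu_le : ∀ x, 0 < x → (lam - 2 * m * r₀) * (|res0 r R Q f lam x| * (1 + x ^ m)) ≤ v x :=
    fun x hx => by
      have := mul_nonneg (ha_nonneg x hx) (hnn x hx)
      rw [hv_split x hx]
      linarith
  have hu_int : IntegrableOn (fun x => res0 r R Q f lam x * (1 + x ^ m)) (Ioi 0) := by
    refine (hv_int.div_const (lam - 2 * m * r₀)).mono'
      (hu_meas.mul hw_meas.aestronglyMeasurable) ?_
    filter_upwards [ae_restrict_mem measurableSet_Ioi] with x (hx : 0 < x)
    have := Real.rpow_nonneg hx.le m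
    rw [norm_mul, Real.norm_of_nonneg (by positivity : 0 ≤ 1 + x ^ m), Real.norm_eq_abs,
      le_div_iff₀' hlam']
    exact hu_le x hx
  refine ⟨hu_int, ?_, ?_, ?_, ?_⟩
  · refine hv_int.mono' ((ha_meas.aestronglyMeasurable.mul hu_meas).mul
      hw_meas.aestronglyMeasurable) ?_
    filter_upwards [ae_restrict_mem measurableSet_Ioi] with x (hx : 0 < x)
    have := Real.rpow_nonneg hx.le m
    have := mul_nonneg hlam'.le (hnn x hx)
    rw [norm_mul, norm_mul, Real.norm_of_nonneg (by positivity : 0 ≤ 1 + x ^ m),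
      Real.norm_of_nonneg (ha_nonneg x hx), Real.norm_eq_abs, hv_split x hx]
    linarith
  · intro x₀ x₁ hx₀ hx₁
    rw [hru x₁ (hx₀.trans_le hx₁), hru x₀ hx₀]
    refine (integral_exp_neg_primitive_mul (F' := h) hg hx₀.le hx₁
      (hh.absolutelyContinuousOnInterval_primitive hx₀.le hx₁) ?_).symm.trans ?_
    · filter_upwards [LocallyIntegrable.ae_hasDerivAt_integral hh] with x hx _ using hx 0
    · refine intervalIntegral.integral_congr fun x hx => ?_
      rw [uIcc_of_le hx₁] at hx
      have hx0 : 0 < x := hx₀.trans_le hx.1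
      have he : Real.exp (-G x) * Real.exp (G x) = 1 := by rw [← Real.exp_add]; simp
      have hhx : h x = f x * Real.exp (G x) := indicator_of_mem (mem_Ioi.2 hx0) _
      change Real.exp (-G x) * (h x - g x * F x) = _
      simp only [hu x hx0, hhx, hgdef]
      linear_combination f x * he
  · have hc : Continuous fun x => Real.exp (-G x) * F x := by fun_prop
    have h0 := (hc.tendsto 0).mono_left (nhdsWithin_le_nhds (s := Ioi (0:ℝ)))
    have hF0 : F 0 = 0 := intervalIntegral.integral_same
    rw [hF0, mul_zero] at h0
    refine h0.congr' ?_
    filter_upwards [self_mem_nhdsWithin] with x hx using (hru x hx).symm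
  · rw [le_div_iff₀' hlam', ← integral_const_mul]
    refine le_trans (integral_mono_of_nonneg ?_ hv_int ?_) hv_le
    · filter_upwards [ae_restrict_mem measurableSet_Ioi] with x hx using
        mul_nonneg hlam'.le (hnn x hx)
    · filter_upwards [ae_restrict_mem measurableSet_Ioi] with x hx using hu_le x hx
end

section
/- Let m ≥ 1, let β : (0,∞) → [0,∞) be measurable with β(x) ≤ β_m (1+x^m) for a.e. x > 0, and let λ > 2m r₀ + β_m. For f ∈ X_m set u₀(x) = (e^{−λR(x)−Q(x)}/r(x)) ∫₀^x f(y) e^{λR(y)+Q(y)} dy, e_λ(x) = e^{−λR(x)−Q(x)}/r(x), and u = u₀ + e_λ · (∫₀^∞ β u₀ dx)/(1 − ∫₀^∞ β e_λ dx). Then λ u(x) + (ru)'(x) + a(x)u(x) = f(x) for a.e. x > 0, lim_{x→0⁺} r(x)u(x) = ∫₀^∞ β(y)u(y) dy, and ‖u‖_m ≤ ‖f‖_m/(λ − 2m r₀ − β_m). -/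
open MeasureTheory Set Filter

namespace AbsolutelyContinuousOnInterval

/-- A `C¹` function of an absolutely continuous function is absolutely continuous. -/
theorem contDiff_comp {φ F : ℝ → ℝ} {a b : ℝ} (hφ : ContDiff ℝ 1 φ)
    (hF : AbsolutelyContinuousOnInterval F a b) :
    AbsolutelyContinuousOnInterval (fun x => φ (F x)) a b := by
  obtain ⟨C, hC⟩ := hF.exists_bound
  obtain ⟨K, hK⟩ := (hφ.contDiffOn (s := Icc (-C) C)).exists_lipschitzOnWith
    (by decide) (convex_Icc _ _) isCompact_Icc
  have hmem : ∀ x ∈ uIcc a b, F x ∈ Icc (-C) C := fun x hx => abs_le.mp (hC x hx)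
  unfold AbsolutelyContinuousOnInterval at hF ⊢
  apply squeeze_zero' ?_ ?_ (by simpa using hF.const_mul (K : ℝ))
  · exact Eventually.of_forall fun _ => Finset.sum_nonneg fun i hi => dist_nonneg
  rw [eventually_inf_principal]
  filter_upwards with E hE
  simp only [Finset.mul_sum]
  exact Finset.sum_le_sum fun i hi =>
    hK.dist_le_mul _ (hmem _ (hE.1 i hi).1) _ (hmem _ (hE.1 i hi).2)

/-- Fundamental theorem of calculus with a prescribed almost everywhere derivative. -/
theorem integral_eq_sub_of_ae_hasDerivAt {F F' : ℝ → ℝ} {a b : ℝ}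
    (hF : AbsolutelyContinuousOnInterval F a b)
    (hd : ∀ᵐ x, x ∈ uIcc a b → HasDerivAt F (F' x) x) :
    IntervalIntegrable F' volume a b ∧ ∫ x in a..b, F' x = F b - F a := by
  have h : ∀ᵐ x, x ∈ uIoc a b → deriv F x = F' x := by
    filter_upwards [hd] with x hx hx'
    exact (hx (uIoc_subset_uIcc hx')).deriv
  refine ⟨hF.intervalIntegrable_deriv.congr_ae ?_, ?_⟩
  · exact (ae_restrict_iff' measurableSet_uIoc).mpr h
  · rw [← hF.integral_deriv_eq_sub]
    exact (intervalIntegral.integral_congr_ae h).symm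

end AbsolutelyContinuousOnInterval

theorem continuousOn_Ici_of_forall_Icc {F : ℝ → ℝ} {a : ℝ}
    (h : ∀ b, a ≤ b → ContinuousOn F (Icc a b)) : ContinuousOn F (Ici a) := by
  intro x hx
  have hx : a ≤ x := hx
  refine (h (x + 1) (by linarith) x ⟨hx, by linarith⟩).mono_of_mem_nhdsWithin ?_
  filter_upwards [self_mem_nhdsWithin, mem_nhdsWithin_of_mem_nhds (Iio_mem_nhds (lt_add_one x))]
    with y hy hy' using ⟨hy, le_of_lt hy'⟩

/-- The survival function `x ↦ exp (-∫₀ˣ g)` of a hazard rate `g`. -/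
noncomputable def survival (g : ℝ → ℝ) (x : ℝ) : ℝ :=
  Real.exp (-∫ t in (0 : ℝ)..x, g t)

theorem survival_pos (g : ℝ → ℝ) (x : ℝ) : 0 < survival g x := Real.exp_pos _

theorem survival_zero (g : ℝ → ℝ) : survival g 0 = 1 := by simp [survival]

theorem survival_absolutelyContinuous {g : ℝ → ℝ}
    (hg : ∀ b, 0 ≤ b → IntervalIntegrable g volume 0 b)
    {b : ℝ} (hb : 0 ≤ b) :
    AbsolutelyContinuousOnInterval (survival g) 0 b :=
  ((hg b hb).absolutelyContinuousOnInterval_intervalIntegral left_mem_uIcc).contDiff_comp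
    (φ := fun y => Real.exp (-y)) (by fun_prop)

theorem survival_ae_hasDerivAt {g : ℝ → ℝ}
    (hg : ∀ b, 0 ≤ b → IntervalIntegrable g volume 0 b)
    {b : ℝ} (hb : 0 ≤ b) :
    ∀ᵐ x, x ∈ uIcc 0 b → HasDerivAt (survival g) (-(g x) * survival g x) x := by
  filter_upwards [(hg b hb).ae_hasDerivAt_integral] with x hx hxb
  have := (hx hxb 0 left_mem_uIcc).neg.exp
  rw [mul_comm]
  exact this

theorem survival_continuousOn {g : ℝ → ℝ}
    (hg : ∀ b, 0 ≤ b → IntervalIntegrable g volume 0 b) : ContinuousOn (survival g) (Ici 0) := by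
  refine continuousOn_Ici_of_forall_Icc fun b hb => ?_
  rw [← uIcc_of_le hb]
  exact (survival_absolutelyContinuous hg hb).continuousOn

theorem intervalIntegrable_div_survival {g : ℝ → ℝ}
    (hg : ∀ b, 0 ≤ b → IntervalIntegrable g volume 0 b)
    {f : ℝ → ℝ} (hf : IntegrableOn f (Ioi 0)) {b : ℝ}
    (hb : 0 ≤ b) : IntervalIntegrable (fun y => f y / survival g y) volume 0 b := by
  have hf' : IntervalIntegrable f volume 0 b := by
    rw [intervalIntegrable_iff_integrableOn_Ioc_of_le hb]
    exact hf.mono_set Ioc_subset_Ioi_self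
  simp_rw [div_eq_mul_inv]
  refine hf'.mul_continuousOn ?_
  refine ((survival_continuousOn hg).mono ?_).inv₀ fun y _ => (survival_pos g y).ne'
  rw [uIcc_of_le hb]
  exact Icc_subset_Ici_self

theorem continuousOn_integral_div_survival {g : ℝ → ℝ}
    (hg : ∀ b, 0 ≤ b → IntervalIntegrable g volume 0 b)
    {f : ℝ → ℝ} (hf : IntegrableOn f (Ioi 0)) :
    ContinuousOn (fun x => ∫ y in (0 : ℝ)..x, f y / survival g y) (Ici 0) := by
  refine continuousOn_Ici_of_forall_Icc fun b hb => ?_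
  rw [← uIcc_of_le hb]
  exact ((intervalIntegrable_div_survival hg hf hb).absolutelyContinuousOnInterval_intervalIntegral
    left_mem_uIcc).continuousOn

/-- Variation of constants: `P = survival g * (∫₀ f / survival g + c)` solves `P' = f - g P`. -/
theorem variation_of_constants {g : ℝ → ℝ}
    (hg : ∀ b, 0 ≤ b → IntervalIntegrable g volume 0 b)
    {f : ℝ → ℝ} (hf : IntegrableOn f (Ioi 0)) (c : ℝ) {p q : ℝ}
    (hp : 0 ≤ p) (hpq : p ≤ q) :
    ∫ s in p..q, (f s - g s * (survival g s * ((∫ y in (0 : ℝ)..s, f y / survival g y) + c))) =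
      survival g q * ((∫ y in (0 : ℝ)..q, f y / survival g y) + c) -
      survival g p * ((∫ y in (0 : ℝ)..p, f y / survival g y) + c) := by
  have hq : 0 ≤ q := hp.trans hpq
  have hsub : uIcc p q ⊆ uIcc 0 q := by
    rw [uIcc_of_le hpq, uIcc_of_le hq]
    exact Icc_subset_Icc_left hp
  have hint := intervalIntegrable_div_survival hg hf hq
  have hc : AbsolutelyContinuousOnInterval (fun _ : ℝ => c) 0 q :=
    (contDiff_const (n := 1)).contDiffOn.absolutelyContinuousOnInterval
  have hAC := ((survival_absolutelyContinuous hg hq).fun_mul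
    ((hint.absolutelyContinuousOnInterval_intervalIntegral left_mem_uIcc).fun_add hc)).mono hsub
  refine (hAC.integral_eq_sub_of_ae_hasDerivAt ?_).2
  filter_upwards [survival_ae_hasDerivAt hg hq, hint.ae_hasDerivAt_integral] with x h1 h2 hx
  have h := (h1 (hsub hx)).mul ((h2 (hsub hx) 0 left_mem_uIcc).add_const c)
  refine h.congr_deriv ?_
  have := (survival_pos g x).ne'
  field_simp
  ring

theorem intervalIntegrable_survival_weight {g k : ℝ → ℝ}
    (hg : ∀ b, 0 ≤ b → IntervalIntegrable g volume 0 b)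
    (hk : ∀ b, 0 ≤ b → IntervalIntegrable k volume 0 b) {m : ℝ} (hm : 1 ≤ m)
    {p q : ℝ} (hp : 0 ≤ p) (hpq : p ≤ q) :
    IntervalIntegrable (fun x => survival g x * k x * (1 + x ^ m)) volume p q := by
  have hq := hp.trans hpq
  have hsub : uIcc p q ⊆ Ici 0 := by
    rw [uIcc_of_le hpq]
    exact fun x hx => hp.trans hx.1
  have hk' : IntervalIntegrable k volume p q := (hk p hp).symm.trans (hk q hq)
  have hw : ContinuousOn (fun x : ℝ => 1 + x ^ m) (uIcc p q) :=
    (continuous_const.add (Real.continuous_rpow_const (by linarith))).continuousOn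
  exact (hk'.continuousOn_mul ((survival_continuousOn hg).mono hsub)).mul_continuousOn hw

theorem integral_survival_weight_le {g k : ℝ → ℝ}
    (hg : ∀ b, 0 ≤ b → IntervalIntegrable g volume 0 b)
    (hk : ∀ b, 0 ≤ b → IntervalIntegrable k volume 0 b) {m μ : ℝ} (hm : 1 ≤ m) (hμ : 0 < μ)
    (hgk : ∀ x, 0 < x → m * x ^ (m - 1) + μ * (k x * (1 + x ^ m)) ≤ g x * (1 + x ^ m))
    {p q : ℝ} (hp : 0 ≤ p) (hpq : p ≤ q) :
    ∫ x in p..q, survival g x * k x * (1 + x ^ m) ≤ survival g p * (1 + p ^ m) / μ := by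
  have hq := hp.trans hpq
  have hsub : uIcc p q ⊆ uIcc 0 q := by
    rw [uIcc_of_le hpq, uIcc_of_le hq]
    exact Icc_subset_Icc_left hp
  have hw : AbsolutelyContinuousOnInterval (fun x : ℝ => 1 + x ^ m) 0 q :=
    (contDiff_const.add (Real.contDiff_rpow_const_of_le
      (by exact_mod_cast hm))).contDiffOn.absolutelyContinuousOnInterval
  have hAC := ((survival_absolutelyContinuous hg hq).fun_mul hw).mono hsub
  obtain ⟨hint, heq⟩ := hAC.integral_eq_sub_of_ae_hasDerivAt
    (F' := fun x => survival g x * (m * x ^ (m - 1) - g x * (1 + x ^ m))) (by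
      filter_upwards [survival_ae_hasDerivAt hg hq] with x h1 hx
      have h := (h1 (hsub hx)).mul
        ((Real.hasDerivAt_rpow_const (x := x) (p := m) (Or.inr hm)).const_add 1)
      refine h.congr_deriv ?_
      ring)
  have hle : ∫ x in p..q, μ * (survival g x * k x * (1 + x ^ m)) ≤
      ∫ x in p..q, -(survival g x * (m * x ^ (m - 1) - g x * (1 + x ^ m))) := by
    refine intervalIntegral.integral_mono_on_of_le_Ioo hpq
      ((intervalIntegrable_survival_weight hg hk hm hp hpq).const_mul μ) hint.neg ?_
    intro x hx
    nlinarith [hgk x (hp.trans_lt hx.1), survival_pos g x]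
  rw [intervalIntegral.integral_const_mul, intervalIntegral.integral_neg, heq] at hle
  have hpos : 0 ≤ survival g q * (1 + q ^ m) :=
    mul_nonneg (survival_pos g q).le (by positivity)
  rw [le_div_iff₀ hμ]
  linarith

theorem survival_weight_tail {g k : ℝ → ℝ}
    (hg : ∀ b, 0 ≤ b → IntervalIntegrable g volume 0 b)
    (hk : ∀ b, 0 ≤ b → IntervalIntegrable k volume 0 b) {m μ : ℝ} (hm : 1 ≤ m) (hμ : 0 < μ)
    (hgk : ∀ x, 0 < x → m * x ^ (m - 1) + μ * (k x * (1 + x ^ m)) ≤ g x * (1 + x ^ m))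
    (hk0 : ∀ x, 0 < x → 0 ≤ k x) {p : ℝ} (hp : 0 ≤ p) :
    IntegrableOn (fun x => survival g x * k x * (1 + x ^ m)) (Ioi p) ∧
    ∫ x in Ioi p, survival g x * k x * (1 + x ^ m) ≤ survival g p * (1 + p ^ m) / μ := by
  have hint := fun q (hq : p ≤ q) =>
    intervalIntegrable_survival_weight hg hk hm hp hq
  have hIoi : IntegrableOn (fun x => survival g x * k x * (1 + x ^ m)) (Ioi p) := by
    refine integrableOn_Ioi_of_intervalIntegral_norm_bounded
      (survival g p * (1 + p ^ m) / μ) p (b := fun q => max p q) (l := atTop)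
      (fun q => (intervalIntegrable_iff_integrableOn_Ioc_of_le (le_max_left _ _)).mp
        (hint _ (le_max_left _ _)))
      (tendsto_atTop_mono (fun q => le_max_right p q) tendsto_id) ?_
    filter_upwards with q
    refine le_of_eq_of_le (intervalIntegral.integral_congr_ae ?_)
      (integral_survival_weight_le hg hk hm hμ hgk hp (le_max_left p q))
    filter_upwards with x hx
    rw [uIoc_of_le (le_max_left _ _)] at hx
    have hx0 := hp.trans_lt hx.1
    have := hk0 x hx0
    have := survival_pos g x
    rw [Real.norm_of_nonneg (by positivity)]
  refine ⟨hIoi, le_of_tendsto (intervalIntegral_tendsto_integral_Ioi p hIoi tendsto_id) ?_⟩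
  filter_upwards [eventually_ge_atTop p] with q hq
  exact integral_survival_weight_le hg hk hm hμ hgk hp hq

/-- Tonelli on the triangle `y < x`. -/
theorem lintegral_mul_setLIntegral_Iio {μ : Measure ℝ} [SFinite μ] {K Φ : ℝ → ENNReal}
    (hK : AEMeasurable K μ) (hΦ : AEMeasurable Φ μ) :
    ∫⁻ x, K x * ∫⁻ y in Iio x, Φ y ∂μ ∂μ = ∫⁻ y, Φ y * ∫⁻ x in Ioi y, K x ∂μ ∂μ := by
  have hS : MeasurableSet {z : ℝ × ℝ | z.2 < z.1} := measurableSet_lt measurable_snd measurable_fst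
  have hmeas : AEMeasurable (Function.uncurry fun x y => (Iio x).indicator (fun y => K x * Φ y) y)
      (μ.prod μ) := by
    have h : AEMeasurable (fun z : ℝ × ℝ => K z.1 * Φ z.2) (μ.prod μ) :=
      (hK.comp_quasiMeasurePreserving Measure.quasiMeasurePreserving_fst).mul
        (hΦ.comp_quasiMeasurePreserving Measure.quasiMeasurePreserving_snd)
    refine (h.indicator hS).congr (Eventually.of_forall fun z => ?_)
    simp [Function.uncurry, indicator]
  calc
    _ = ∫⁻ x, ∫⁻ y, (Iio x).indicator (fun y => K x * Φ y) y ∂μ ∂μ := by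
      refine lintegral_congr fun x => ?_
      rw [lintegral_indicator measurableSet_Iio, lintegral_const_mul'' _ hΦ.restrict]
    _ = ∫⁻ y, ∫⁻ x, (Iio x).indicator (fun y => K x * Φ y) y ∂μ ∂μ :=
      lintegral_lintegral_swap hmeas
    _ = _ := by
      refine lintegral_congr fun y => ?_
      rw [← lintegral_const_mul'' _ hK.restrict, ← lintegral_indicator measurableSet_Ioi]
      refine lintegral_congr fun x => ?_
      simp [indicator, mul_comm]

/-- The solution with zero boundary value belongs to the weighted space, with norm at most
`‖f‖ / μ`. -/
theorem zero_boundary_solution_bound {g k : ℝ → ℝ}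
    (hg : ∀ b, 0 ≤ b → IntervalIntegrable g volume 0 b)
    (hk : ∀ b, 0 ≤ b → IntervalIntegrable k volume 0 b) (hk0 : ∀ x, 0 < x → 0 ≤ k x)
    (hkc : ContinuousOn k (Ioi 0)) {m μ : ℝ} (hm : 1 ≤ m) (hμ : 0 < μ)
    (hgk : ∀ x, 0 < x → m * x ^ (m - 1) + μ * (k x * (1 + x ^ m)) ≤ g x * (1 + x ^ m))
    {f : ℝ → ℝ} (hf : IntegrableOn f (Ioi 0))
    (hfw : IntegrableOn (fun x => |f x| * (1 + x ^ m)) (Ioi 0)) :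
    IntegrableOn (fun x => |survival g x * k x * ∫ y in (0 : ℝ)..x, f y / survival g y| *
      (1 + x ^ m)) (Ioi 0) ∧
    ∫ x in Ioi 0, |survival g x * k x * ∫ y in (0 : ℝ)..x, f y / survival g y| * (1 + x ^ m) ≤
      (∫ x in Ioi 0, |f x| * (1 + x ^ m)) / μ := by
  have hEc := (survival_continuousOn hg).mono Ioi_subset_Ici_self
  have hw : ContinuousOn (fun x : ℝ => 1 + x ^ m) (Ioi 0) :=
    (continuous_const.add (Real.continuous_rpow_const (by linarith))).continuousOn
  have hmeas : AEStronglyMeasurable (fun x =>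
      |survival g x * k x * ∫ y in (0 : ℝ)..x, f y / survival g y| * (1 + x ^ m))
      (volume.restrict (Ioi 0)) :=
    (((hEc.mul hkc).mul ((continuousOn_integral_div_survival hg hf).mono
      Ioi_subset_Ici_self)).abs.mul hw).aestronglyMeasurable measurableSet_Ioi
  have hKm : AEMeasurable (fun x => ENNReal.ofReal (survival g x * k x * (1 + x ^ m)))
      (volume.restrict (Ioi 0)) :=
    (((hEc.mul hkc).mul hw).aemeasurable measurableSet_Ioi).ennreal_ofReal
  have hΦm : AEMeasurable (fun y => ‖f y / survival g y‖ₑ) (volume.restrict (Ioi 0)) :=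
    (hf.aestronglyMeasurable.aemeasurable.div (hEc.aemeasurable measurableSet_Ioi)).enorm
  have hnn : ∀ x ∈ Ioi (0 : ℝ), 0 ≤ |f x| * (1 + x ^ m) / μ := fun x hx => by
    have : 0 < x := hx
    positivity
  have hlint : ∫⁻ x in Ioi 0, ‖|survival g x * k x * ∫ y in (0 : ℝ)..x, f y / survival g y| *
      (1 + x ^ m)‖ₑ ≤ ENNReal.ofReal ((∫ x in Ioi 0, |f x| * (1 + x ^ m)) / μ) := by
    calc
      _ ≤ ∫⁻ x in Ioi 0, ENNReal.ofReal (survival g x * k x * (1 + x ^ m)) *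
            ∫⁻ y in Iio x, ‖f y / survival g y‖ₑ ∂(volume.restrict (Ioi 0)) := by
        refine setLIntegral_mono' measurableSet_Ioi fun x hx => ?_
        have hx : 0 < x := hx
        have h0 : 0 ≤ survival g x * k x * (1 + x ^ m) :=
          mul_nonneg (mul_nonneg (survival_pos g x).le (hk0 x hx)) (by positivity)
        have he : ‖|survival g x * k x * ∫ y in (0 : ℝ)..x, f y / survival g y| *
            (1 + x ^ m)‖ₑ = ENNReal.ofReal (survival g x * k x * (1 + x ^ m)) *
              ‖∫ y in (0 : ℝ)..x, f y / survival g y‖ₑ := by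
          rw [← Real.enorm_of_nonneg h0, ← enorm_mul, enorm_mul, Real.enorm_abs, ← enorm_mul]
          congr 1
          ring
        rw [he, intervalIntegral.integral_of_le hx.le, integral_Ioc_eq_integral_Ioo,
          Measure.restrict_restrict measurableSet_Iio, Iio_inter_Ioi]
        gcongr
        exact enorm_integral_le_lintegral_enorm _
      _ = ∫⁻ y in Ioi 0, ‖f y / survival g y‖ₑ * ∫⁻ x in Ioi y,
            ENNReal.ofReal (survival g x * k x * (1 + x ^ m)) ∂(volume.restrict (Ioi 0)) :=
        lintegral_mul_setLIntegral_Iio hKm hΦm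
      _ ≤ ∫⁻ y in Ioi 0, ENNReal.ofReal (|f y| * (1 + y ^ m) / μ) := by
        refine setLIntegral_mono' measurableSet_Ioi fun y hy => ?_
        have hy : 0 < y := hy
        obtain ⟨hi, hle⟩ := survival_weight_tail hg hk hm hμ hgk hk0 hy.le
        rw [Measure.restrict_restrict measurableSet_Ioi,
          inter_eq_left.mpr (Ioi_subset_Ioi hy.le), ← ofReal_integral_eq_lintegral_ofReal hi]
        · rw [← ofReal_norm, ← ENNReal.ofReal_mul (norm_nonneg _)]
          refine ENNReal.ofReal_le_ofReal
            ((mul_le_mul_of_nonneg_left hle (norm_nonneg _)).trans (le_of_eq ?_))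
          have := survival_pos g y
          rw [Real.norm_eq_abs, abs_div, abs_of_pos this]
          field_simp
        · filter_upwards [ae_restrict_mem measurableSet_Ioi] with x hx
          have hx : 0 < x := hy.trans hx
          exact mul_nonneg (mul_nonneg (survival_pos g x).le (hk0 x hx)) (by positivity)
      _ = _ := by
        rw [← ofReal_integral_eq_lintegral_ofReal (hfw.div_const μ), integral_div]
        filter_upwards [ae_restrict_mem measurableSet_Ioi] with x hx using hnn x hx
  refine ⟨⟨hmeas, hlint.trans_lt ENNReal.ofReal_lt_top⟩, ?_⟩
  have h0 : 0 ≤ (∫ x in Ioi 0, |f x| * (1 + x ^ m)) / μ := by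
    rw [← integral_div]
    exact setIntegral_nonneg measurableSet_Ioi hnn
  refine (Real.le_norm_self _).trans ((ENNReal.ofReal_le_ofReal_iff h0).mp ?_)
  rw [ofReal_norm]
  exact (enorm_integral_le_lintegral_enorm _).trans hlint

/-- Integration against a rate `β ≤ B w` is bounded on `L¹(w)`. -/
theorem integral_mul_le_of_le_weight {ν : Measure ℝ} {β w h : ℝ → ℝ} {B : ℝ}
    (hβ : AEStronglyMeasurable β ν) (hβ0 : ∀ᵐ x ∂ν, 0 ≤ β x) (hβw : ∀ᵐ x ∂ν, β x ≤ B * w x)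
    (hh : AEStronglyMeasurable h ν) (hint : Integrable (fun x => |h x| * w x) ν) :
    Integrable (fun x => β x * h x) ν ∧
    |∫ x, β x * h x ∂ν| ≤ B * ∫ x, |h x| * w x ∂ν := by
  have hle : ∀ᵐ x ∂ν, ‖β x * h x‖ ≤ B * (|h x| * w x) := by
    filter_upwards [hβ0, hβw] with x h0 h1
    rw [norm_mul, Real.norm_of_nonneg h0, Real.norm_eq_abs]
    nlinarith [mul_le_mul_of_nonneg_right h1 (abs_nonneg (h x))]
  refine ⟨(hint.const_mul B).mono' (hβ.mul hh) hle, ?_⟩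
  rw [← integral_const_mul, ← Real.norm_eq_abs]
  exact norm_integral_le_of_norm_le (hint.const_mul B) hle

/-- For `λ > 2 m r₀ + β_m` and `f ∈ X_m`, the function
`u = u₀ + e_λ (∫β u₀)/(1-∫β e_λ) = R(λ,Z_{β,m})f` solves `λu + (ru)' + au = f` a.e.,
satisfies the McKendrick–von Foerster boundary condition
`lim_{x→0⁺} r(x)u(x) = ∫₀^∞ β u`, and `‖u‖_m ≤ ‖f‖_m/(λ - 2 m r₀ - β_m)`. -/
theorem resolvent_Zbeta (m r₀ betam lam : ℝ) (r a β R Q f : ℝ → ℝ)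
    (hm : 1 ≤ m) (hr₀ : 0 < r₀)
    (hr_cont : ContinuousOn r (Ioi 0))
    (hr_pos : ∀ x, 0 < x → 0 < r x)
    (hr_bound : ∀ x, 0 < x → r x ≤ r₀ * (1 + x))
    (hr_int : IntegrableOn (fun s => 1 / r s) (Ioo 0 1))
    (ha_meas : Measurable a)
    (ha_nonneg : ∀ x, 0 < x → 0 ≤ a x)
    (ha_locbdd : ∀ c, 0 < c → ∃ M, ∀ x ∈ Ioc (0:ℝ) c, a x ≤ M)
    (hβ_meas : Measurable β)
    (hβ_nonneg : ∀ x, 0 < x → 0 ≤ β x)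
    (hβm : 0 ≤ betam)
    (hβ_bound : ∀ᵐ x ∂volume.restrict (Ioi 0), β x ≤ betam * (1 + x ^ m))
    (hR : ∀ x, 0 < x → R x = ∫ s in Ioo (0:ℝ) x, 1 / r s)
    (hQ : ∀ x, 0 < x → Q x = ∫ s in Ioo (0:ℝ) x, a s / r s)
    (hlam : 2 * m * r₀ + betam < lam)
    (hf_meas : Measurable f)
    (hf_int : IntegrableOn (fun x => f x * (1 + x ^ m)) (Ioi 0)) :
    ∀ u : ℝ → ℝ,
    (∀ x, u x = res0 r R Q f lam x +
        elam r R Q lam x *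
          ((∫ y in Ioi 0, β y * res0 r R Q f lam y) /
            (1 - ∫ y in Ioi 0, β y * elam r R Q lam y))) →
    -- ru is locally absolutely continuous and λu + (ru)' + au = f holds a.e.
    ((∀ x₀ x₁ : ℝ, 0 < x₀ → x₀ ≤ x₁ →
      r x₁ * u x₁ - r x₀ * u x₀ =
        ∫ s in x₀..x₁, (f s - lam * u s - a s * u s)) ∧
    -- McKendrick–von Foerster boundary condition
    Tendsto (fun x => r x * u x) (nhdsWithin 0 (Ioi 0))
      (nhds (∫ y in Ioi 0, β y * u y)) ∧
    -- resolvent estimate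
    ∫ x in Ioi 0, |u x| * (1 + x ^ m)
      ≤ (∫ x in Ioi 0, |f x| * (1 + x ^ m)) / (lam - 2 * m * r₀ - betam)) := by
  intro u hu
  set k : ℝ → ℝ := fun x => 1 / r x with hk_def
  set g : ℝ → ℝ := fun x => lam * k x + a x / r x with hg_def
  set μ : ℝ := lam - 2 * m * r₀ with hμ_def
  have hμ : 0 < μ := by linarith
  have hμB : 0 < μ - betam := by linarith
  have hk0 : ∀ x, 0 < x → 0 ≤ k x := fun x hx => (one_div_pos.mpr (hr_pos x hx)).le
  have hkc : ContinuousOn k (Ioi 0) :=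
    continuousOn_const.div hr_cont fun x hx => (hr_pos x hx).ne'
  have hk : ∀ b, 0 ≤ b → IntervalIntegrable k volume 0 b := by
    intro b hb
    have h1 : IntervalIntegrable k volume 0 1 := by
      rwa [intervalIntegrable_iff_integrableOn_Ioo_of_le zero_le_one]
    rcases hb.eq_or_lt with rfl | hb
    · exact IntervalIntegrable.refl
    · refine h1.trans (ContinuousOn.intervalIntegrable (hkc.mono fun x hx => ?_))
      exact (lt_min one_pos hb).trans_le hx.1
  have haq : ∀ b, 0 ≤ b → IntervalIntegrable (fun x => a x / r x) volume 0 b := by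
    intro b hb
    rcases hb.eq_or_lt with rfl | hb
    · exact IntervalIntegrable.refl
    obtain ⟨M, hM⟩ := ha_locbdd b hb
    have hkb := (intervalIntegrable_iff_integrableOn_Ioc_of_le hb.le).mp (hk b hb.le)
    rw [intervalIntegrable_iff_integrableOn_Ioc_of_le hb.le]
    have h := Integrable.bdd_mul hkb ha_meas.aestronglyMeasurable (c := M) (by
      filter_upwards [ae_restrict_mem measurableSet_Ioc] with x hx
      rw [Real.norm_of_nonneg (ha_nonneg x hx.1)]
      exact hM x hx)
    refine h.congr (Eventually.of_forall fun x => ?_)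
    simp [hk_def, div_eq_mul_inv]
  have hg : ∀ b, 0 ≤ b → IntervalIntegrable g volume 0 b := fun b hb =>
    ((hk b hb).const_mul lam).add (haq b hb)
  have hgk : ∀ x, 0 < x → m * x ^ (m - 1) + μ * (k x * (1 + x ^ m)) ≤ g x * (1 + x ^ m) := by
    intro x hx
    have hr := hr_pos x hx
    have hxm : 0 < x ^ m := by positivity
    have hpow : x ^ m = x ^ (m - 1) * x := by
      rw [← Real.rpow_add_one hx.ne', sub_add_cancel]
    have hpow' : x ^ (m - 1) ≤ 1 + x ^ m := by
      rcases le_total x 1 with h | h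
      · linarith [Real.rpow_le_one hx.le h (sub_nonneg.mpr hm)]
      · linarith [Real.rpow_le_rpow_of_exponent_le h (sub_le_self m zero_le_one)]
    have h1 : x ^ (m - 1) * r x ≤ 2 * r₀ * (1 + x ^ m) := by
      have h2 := mul_le_mul_of_nonneg_left (hr_bound x hx) (by positivity : 0 ≤ x ^ (m - 1))
      nlinarith
    have h3 : x ^ (m - 1) ≤ 2 * r₀ * (1 + x ^ m) * k x := by
      rw [hk_def, mul_one_div, le_div_iff₀ hr]
      exact h1
    have h4 : 0 ≤ a x / r x * (1 + x ^ m) :=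
      mul_nonneg (div_nonneg (ha_nonneg x hx) hr.le) (by positivity)
    have h5 := mul_le_mul_of_nonneg_left h3 (zero_le_one.trans hm)
    simp only [hg_def, hμ_def]
    nlinarith
  have hexp : ∀ x, 0 < x → lam * R x + Q x = ∫ t in (0 : ℝ)..x, g t := by
    intro x hx
    rw [hR x hx, hQ x hx, hg_def, intervalIntegral.integral_add
      ((hk x hx.le).const_mul lam) (haq x hx.le), intervalIntegral.integral_const_mul,
      intervalIntegral.integral_of_le hx.le, intervalIntegral.integral_of_le hx.le,
      integral_Ioc_eq_integral_Ioo, integral_Ioc_eq_integral_Ioo]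
  have helam : ∀ x, 0 < x → elam r R Q lam x = survival g x * k x := by
    intro x hx
    rw [elam, survival, ← hexp x hx, hk_def, mul_one_div]
    congr 2
    ring
  have hres : ∀ x, 0 < x → res0 r R Q f lam x =
      survival g x * k x * ∫ y in (0 : ℝ)..x, f y / survival g y := by
    intro x hx
    rw [← helam x hx, res0, elam, intervalIntegral.integral_of_le hx.le,
      integral_Ioc_eq_integral_Ioo]
    congr 1
    refine setIntegral_congr_fun measurableSet_Ioo fun y hy => ?_
    simp only [survival]
    rw [hexp y hy.1, Real.exp_neg, div_inv_eq_mul]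
  have hfw : IntegrableOn (fun x => |f x| * (1 + x ^ m)) (Ioi 0) := by
    refine hf_int.norm.congr ?_
    filter_upwards [ae_restrict_mem measurableSet_Ioi] with x hx
    have hx : 0 < x := hx
    rw [norm_mul, Real.norm_eq_abs, Real.norm_of_nonneg (by positivity)]
  have hf : IntegrableOn f (Ioi 0) := by
    refine hfw.mono' hf_meas.aestronglyMeasurable ?_
    filter_upwards [ae_restrict_mem measurableSet_Ioi] with x hx
    have hx : 0 < x := hx
    exact le_mul_of_one_le_right (abs_nonneg _) (by linarith [Real.rpow_pos_of_pos hx m])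
  obtain ⟨hi0, hle0⟩ := zero_boundary_solution_bound hg hk hk0 hkc hm hμ hgk hf hfw
  obtain ⟨hie, hlee⟩ := survival_weight_tail hg hk hm hμ hgk hk0 le_rfl
  have hEkc : ContinuousOn (fun x => survival g x * k x) (Ioi 0) :=
    ((survival_continuousOn hg).mono Ioi_subset_Ici_self).mul hkc
  set e : ℝ → ℝ := fun x => survival g x * k x with he_def
  set v : ℝ → ℝ := fun x => survival g x * k x * ∫ y in (0 : ℝ)..x, f y / survival g y with hv_def
  have he0 : ∀ x, 0 < x → 0 ≤ e x := fun x hx => mul_nonneg (survival_pos g x).le (hk0 x hx)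
  have hvm : AEStronglyMeasurable v (volume.restrict (Ioi 0)) :=
    (hEkc.mul ((continuousOn_integral_div_survival hg hf).mono
      Ioi_subset_Ici_self)).aestronglyMeasurable measurableSet_Ioi
  have hie' : IntegrableOn (fun x => |e x| * (1 + x ^ m)) (Ioi 0) :=
    hie.congr_fun (fun x hx => by
      change e x * _ = |e x| * _
      rw [abs_of_nonneg (he0 x hx)]) measurableSet_Ioi
  have hlee' : ∫ x in Ioi 0, |e x| * (1 + x ^ m) ≤ 1 / μ := by
    rw [survival_zero, Real.zero_rpow (by linarith), add_zero, one_mul] at hlee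
    refine le_of_eq_of_le (setIntegral_congr_fun measurableSet_Ioi fun x hx => ?_) hlee
    change |e x| * _ = e x * _
    rw [abs_of_nonneg (he0 x hx)]
  have hβ0 : ∀ᵐ x ∂volume.restrict (Ioi 0), 0 ≤ β x := by
    filter_upwards [ae_restrict_mem measurableSet_Ioi] with x hx using hβ_nonneg x hx
  obtain ⟨hβv, hβv'⟩ := integral_mul_le_of_le_weight hβ_meas.aestronglyMeasurable hβ0 hβ_bound
    hvm hi0
  obtain ⟨hβe, hβe'⟩ := integral_mul_le_of_le_weight hβ_meas.aestronglyMeasurable hβ0 hβ_bound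
    (hEkc.aestronglyMeasurable measurableSet_Ioi) hie'
  have hres_int : ∫ x in Ioi 0, β x * res0 r R Q f lam x = ∫ x in Ioi 0, β x * v x :=
    setIntegral_congr_fun measurableSet_Ioi fun x hx => congrArg (β x * ·) (hres x hx)
  have helam_int : ∫ x in Ioi 0, β x * elam r R Q lam x = ∫ x in Ioi 0, β x * e x :=
    setIntegral_congr_fun measurableSet_Ioi fun x hx => congrArg (β x * ·) (helam x hx)
  rw [hres_int, helam_int] at hu
  set Iv := ∫ x in Ioi 0, β x * v x with hIv
  set Ie := ∫ x in Ioi 0, β x * e x with hIe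
  set F := ∫ x in Ioi 0, |f x| * (1 + x ^ m)
  have hF0 : 0 ≤ F := setIntegral_nonneg measurableSet_Ioi fun x hx => by
    have : 0 < x := hx
    positivity
  have hIe1 : Ie ≤ betam / μ := by
    have := (le_abs_self _).trans (hβe'.trans (mul_le_mul_of_nonneg_left hlee' hβm))
    rwa [mul_one_div] at this
  have hIv1 : |Iv| ≤ betam * (F / μ) := hβv'.trans (mul_le_mul_of_nonneg_left hle0 hβm)
  have hden : (μ - betam) / μ ≤ 1 - Ie := by
    rw [sub_div, div_self hμ.ne']
    linarith
  have hdenpos : 0 < 1 - Ie := (div_pos hμB hμ).trans_le hden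
  set c := Iv / (1 - Ie) with hc_def
  have hu' : ∀ x, 0 < x → u x = v x + e x * c := fun x hx => by
    rw [hu x, hres x hx, helam x hx]
  have hru : ∀ x, 0 < x →
      r x * u x = survival g x * ((∫ y in (0 : ℝ)..x, f y / survival g y) + c) := by
    intro x hx
    have := (hr_pos x hx).ne'
    rw [hu' x hx]
    simp only [hv_def, he_def, hk_def]
    field_simp
  refine ⟨fun x₀ x₁ h0 h01 => ?_, ?_, ?_⟩
  · rw [hru x₁ (h0.trans_le h01), hru x₀ h0, ← variation_of_constants hg hf c h0.le h01]
    refine intervalIntegral.integral_congr fun s hs => ?_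
    rw [uIcc_of_le h01] at hs
    have hs0 : 0 < s := h0.trans_le hs.1
    have := (hr_pos s hs0).ne'
    rw [← hru s hs0]
    simp only [hg_def, hk_def]
    field_simp
    ring
  · have hβu : ∫ y in Ioi 0, β y * u y = c := by
      have heq : EqOn (fun x => β x * u x) (fun x => β x * v x + β x * e x * c) (Ioi 0) :=
        fun x hx => by
          change β x * u x = _
          rw [hu' x hx]
          ring
      rw [setIntegral_congr_fun measurableSet_Ioi heq, integral_add hβv
        (hβe.mul_const c), integral_mul_const, ← hIv, ← hIe, hc_def]
      field_simp
      ring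
    rw [hβu]
    have hcont : ContinuousWithinAt
        (fun x => survival g x * ((∫ y in (0 : ℝ)..x, f y / survival g y) + c)) (Ioi 0) 0 :=
      (((survival_continuousOn hg).mul ((continuousOn_integral_div_survival hg hf).add
        continuousOn_const)) 0 self_mem_Ici).mono Ioi_subset_Ici_self
    have hlim := hcont.tendsto
    rw [survival_zero, intervalIntegral.integral_same, zero_add, one_mul] at hlim
    refine hlim.congr' ?_
    filter_upwards [self_mem_nhdsWithin] with x hx using (hru x hx).symm
  · have hcabs : |c| ≤ betam * F / (μ - betam) := by
      rw [hc_def, abs_div, abs_of_pos hdenpos]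
      calc |Iv| / (1 - Ie) ≤ betam * (F / μ) / ((μ - betam) / μ) :=
            div_le_div₀ (by positivity) hIv1 (div_pos hμB hμ) hden
        _ = _ := by field_simp
    calc
      ∫ x in Ioi 0, |u x| * (1 + x ^ m) ≤
          ∫ x in Ioi 0, (|v x| * (1 + x ^ m) + |e x| * (1 + x ^ m) * |c|) := by
        refine integral_mono_of_nonneg ?_ (hi0.add (hie'.mul_const _)) ?_
        · filter_upwards [ae_restrict_mem measurableSet_Ioi] with x hx
          have : 0 < x := hx
          positivity
        · filter_upwards [ae_restrict_mem measurableSet_Ioi] with x hx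
          have hx : 0 < x := hx
          have hw : 0 ≤ 1 + x ^ m := by positivity
          have := mul_le_mul_of_nonneg_right (abs_add_le (v x) (e x * c)) hw
          rw [abs_mul (e x) c] at this
          change |u x| * (1 + x ^ m) ≤ |v x| * (1 + x ^ m) + |e x| * (1 + x ^ m) * |c|
          rw [hu' x hx]
          linarith
      _ = (∫ x in Ioi 0, |v x| * (1 + x ^ m)) + (∫ x in Ioi 0, |e x| * (1 + x ^ m)) * |c| := by
        rw [integral_add hi0 (hie'.mul_const _), integral_mul_const]
      _ ≤ F / μ + 1 / μ * (betam * F / (μ - betam)) := by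
        gcongr
      _ = F / (μ - betam) := by
        field_simp
        ring
end

section
/- Let m ≥ 1 and let r : (0,∞) → (0,∞) be continuous with r(x) ≤ r₀(1+x) for some r₀ > 0. Let u : (0,∞) → ℝ be measurable with ∫₀^∞ |u(x)|(1+x^m) dx < ∞, suppose ru is locally absolutely continuous on (0,∞) with ∫₀^∞ |(ru)'(x)|(1+x^m) dx < ∞. Then lim_{x→∞} r(x)u(x)(1+x^m) = 0. -/
open MeasureTheory Set Filter

/-- The integral over the tail `(x, ∞)` of a function integrable on `(0, ∞)` vanishes as
`x → ∞`. -/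
lemma tendsto_integral_Ioi_atTop_zero {g : ℝ → ℝ} (hg : IntegrableOn g (Ioi 0)) :
    Tendsto (fun x => ∫ s in Ioi x, g s) atTop (nhds 0) := by
  have h := intervalIntegral_tendsto_integral_Ioi 0 hg tendsto_id
  have h' := (tendsto_const_nhds (x := ∫ s in Ioi (0 : ℝ), g s)).sub h
  rw [sub_self] at h'
  refine h'.congr' ?_
  filter_upwards [eventually_ge_atTop 0] with x hx
  have := intervalIntegral.integral_interval_add_Ioi hg (hg.mono_set (Ioi_subset_Ioi hx))
  simp only [id]
  linarith

/-- If `|v| (1 + x ^ m)` is integrable on `(0, ∞)` then so is `|v|`, even when `v` itself is not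
assumed measurable. -/
lemma integrableOn_abs_of_weighted {m : ℝ} {v : ℝ → ℝ}
    (hv : IntegrableOn (fun x => |v x| * (1 + x ^ m)) (Ioi 0)) :
    IntegrableOn (fun x => |v x|) (Ioi 0) := by
  have hpow : ∀ x : ℝ, x ∈ Ioi (0 : ℝ) → 0 < x ^ m := fun x hx => Real.rpow_pos_of_pos hx m
  have hmeas : Measurable fun x : ℝ => (1 + x ^ m)⁻¹ := by fun_prop
  refine Integrable.mono' hv ?_ ?_
  · refine (hv.aestronglyMeasurable.mul hmeas.aestronglyMeasurable).congr ?_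
    filter_upwards [ae_restrict_mem measurableSet_Ioi] with x hx
    have : 1 + x ^ m ≠ 0 := by linarith [hpow x hx]
    simp [this]
  · filter_upwards [ae_restrict_mem measurableSet_Ioi] with x hx
    rw [Real.norm_eq_abs, abs_abs]
    nlinarith [hpow x hx, abs_nonneg (v x)]

/-- If `u ∈ X_m` and `ru` is locally absolutely continuous on `(0,∞)` with
`(ru)' ∈ X_m`, then `lim_{x→∞} r(x) u(x) (1+x^m) = 0`. -/
theorem decay_at_infinity (m r₀ : ℝ) (r u du : ℝ → ℝ)
    (hm : 1 ≤ m) (hr₀ : 0 < r₀)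
    (hr_cont : ContinuousOn r (Ioi 0))
    (hr_pos : ∀ x, 0 < x → 0 < r x)
    (hr_bound : ∀ x, 0 < x → r x ≤ r₀ * (1 + x))
    (hu_meas : Measurable u)
    (hu_int : IntegrableOn (fun x => |u x| * (1 + x ^ m)) (Ioi 0))
    (hdu_int : IntegrableOn (fun x => |du x| * (1 + x ^ m)) (Ioi 0))
    (hFTC : ∀ x₀ x₁ : ℝ, 0 < x₀ → x₀ ≤ x₁ →
      r x₁ * u x₁ - r x₀ * u x₀ = ∫ s in x₀..x₁, du s) :
    Tendsto (fun x => r x * u x * (1 + x ^ m)) atTop (nhds 0) := by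
  have habs := integrableOn_abs_of_weighted hdu_int
  have hincr : ∀ x y : ℝ, 0 < x → x ≤ y →
      |r y * u y - r x * u x| ≤ ∫ s in Ioi x, |du s| := by
    intro x y hx hxy
    rw [hFTC x y hx hxy, intervalIntegral.integral_of_le hxy]
    refine (norm_integral_le_integral_norm du).trans ?_
    exact setIntegral_mono_set (habs.mono_set (Ioi_subset_Ioi hx.le))
      (Eventually.of_forall fun s => abs_nonneg _) Ioc_subset_Ioi_self.eventuallyLE
  have htail : ∀ x : ℝ, 0 < x → |r x * u x| ≤ ∫ s in Ioi x, |du s| := by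
    intro x hx
    by_contra! hlt
    set c := |r x * u x| - ∫ s in Ioi x, |du s| with hc
    have hcpos : 0 < c := by linarith
    have hlower : ∀ y ∈ Ioi (max x 1), c / r₀ ≤ |u y| * (1 + y ^ m) := by
      intro y hy
      obtain ⟨hxy, h1y⟩ := max_lt_iff.mp (mem_Ioi.mp hy)
      have hy0 : 0 < y := by linarith
      have hru : c ≤ r y * |u y| := by
        have h₁ := hincr x y hx hxy.le
        have h₂ := abs_sub_abs_le_abs_sub (r x * u x) (r y * u y)
        rw [abs_sub_comm] at h₂
        rw [abs_mul (r y), abs_of_pos (hr_pos y hy0)] at h₂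
        linarith
      have hpow : y ≤ y ^ m := Real.self_le_rpow_of_one_le h1y.le hm
      rw [div_le_iff₀ hr₀]
      calc c ≤ r y * |u y| := hru
        _ ≤ r₀ * (1 + y) * |u y| := by gcongr; exact hr_bound y hy0
        _ ≤ r₀ * (1 + y ^ m) * |u y| := by gcongr
        _ = |u y| * (1 + y ^ m) * r₀ := by ring
    have hconst : IntegrableOn (fun _ : ℝ => c / r₀) (Ioi (max x 1)) := by
      refine Integrable.mono' (hu_int.mono_set (Ioi_subset_Ioi (by positivity)))
        aestronglyMeasurable_const ?_
      filter_upwards [ae_restrict_mem measurableSet_Ioi] with y hy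
      rw [Real.norm_eq_abs, abs_of_pos (by positivity)]
      exact hlower y hy
    rw [integrableOn_const_iff] at hconst
    simp [hcpos.ne', hr₀.ne'] at hconst
  refine squeeze_zero_norm' ?_ (tendsto_integral_Ioi_atTop_zero hdu_int)
  filter_upwards [eventually_gt_atTop 0] with x hx
  have hpow : 0 < x ^ m := Real.rpow_pos_of_pos hx m
  rw [Real.norm_eq_abs, abs_mul, abs_of_pos (by positivity : 0 < 1 + x ^ m)]
  calc |r x * u x| * (1 + x ^ m) ≤ (∫ s in Ioi x, |du s|) * (1 + x ^ m) := by
        gcongr; exact htail x hx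
    _ = ∫ s in Ioi x, |du s| * (1 + x ^ m) := (integral_mul_const _ _).symm
    _ ≤ ∫ s in Ioi x, |du s| * (1 + s ^ m) := by
        refine setIntegral_mono_on ((habs.mono_set (Ioi_subset_Ioi hx.le)).mul_const _)
          (hdu_int.mono_set (Ioi_subset_Ioi hx.le)) measurableSet_Ioi fun s hs => ?_
        have : x ≤ s := le_of_lt hs
        gcongr
end

section
/- Let m > 1, let r : (0,∞) → (0,∞) be continuous with r(x) ≤ r₀(1+x), let a : (0,∞) → [0,∞) be measurable and locally bounded, let β : (0,∞) → [0,∞) be measurable with β(x) ≤ β_m(1+x^m), and let b ≥ 0 be measurable with b(x,y) = 0 for x > y, ∫₀^y x b(x,y) dx = y, and n₀(y) := ∫₀^y b(x,y) dx ≤ b₀(1+y^l) with 0 ≤ l ≤ m. Let u ≥ 0 be such that u, a·u ∈ X_m, ru is locally absolutely continuous with (ru)' ∈ X_m, and lim_{x→0⁺} r(x)u(x) = ∫₀^∞ β u dx. Then all the integrals below converge absolutely and ∫₀^∞ [−(ru)'(x) − a(x)u(x) + ∫_x^∞ a(y)b(x,y)u(y) dy](1+x^m) dx = ∫₀^∞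 β(x)u(x) dx + m∫₀^∞ r(x)u(x)x^{m−1} dx − ∫₀^∞ (N₀(x)+N_m(x)) a(x)u(x) dx, where N_j(x) = x^j − n_j(x) and n_j(y) = ∫₀^y x^j b(x,y) dx. -/
open MeasureTheory Set Filter

/-- A function on the half-line that vanishes beyond `y` is determined, up to null sets, on
`Ioo 0 y`. -/
lemma ae_diff_Ioo_eq_zero {f : ℝ → ℝ} {y : ℝ} (hf : ∀ x, y < x → f x = 0) :
    ∀ᵐ x, x ∈ Ioi (0:ℝ) \ Ioo 0 y → f x = 0 := by
  filter_upwards [compl_mem_ae_iff.mpr (measure_singleton y)] with x hxy hx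
  have hne : x ≠ y := hxy
  have hle : y ≤ x := not_lt.mp fun h => hx.2 ⟨hx.1, h⟩
  exact hf x (lt_of_le_of_ne hle hne.symm)

/-- Fubini's theorem for a nonnegative kernel acting on a function on the half-line. -/
lemma integral_kernel_swap {k : ℝ → ℝ → ℝ} {g : ℝ → ℝ}
    (hk_meas : Measurable (Function.uncurry k))
    (hk_nonneg : ∀ x y, 0 < x → 0 ≤ k x y)
    (hk_int : ∀ y, 0 < y → IntegrableOn (fun x => k x y) (Ioi 0))
    (hg : AEStronglyMeasurable g (volume.restrict (Ioi 0)))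
    (hgk : IntegrableOn (fun y => g y * ∫ x in Ioi 0, k x y) (Ioi 0)) :
    IntegrableOn (fun x => ∫ y in Ioi 0, g y * k x y) (Ioi 0) ∧
      ∫ x in Ioi 0, ∫ y in Ioi 0, g y * k x y = ∫ y in Ioi 0, g y * ∫ x in Ioi 0, k x y := by
  have hF : Integrable (Function.uncurry fun x y => g y * k x y)
      ((volume.restrict (Ioi (0:ℝ))).prod (volume.restrict (Ioi (0:ℝ)))) := by
    have hmeas : AEStronglyMeasurable (Function.uncurry fun x y => g y * k x y)
        ((volume.restrict (Ioi (0:ℝ))).prod (volume.restrict (Ioi (0:ℝ)))) :=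
      hg.comp_snd.mul hk_meas.aestronglyMeasurable
    refine (integrable_prod_iff' hmeas).mpr ⟨?_, ?_⟩
    · filter_upwards [ae_restrict_mem measurableSet_Ioi] with y hy
      exact (hk_int y hy).const_mul (g y)
    · refine hgk.norm.congr ?_
      filter_upwards with y
      have hnn : 0 ≤ ∫ x in Ioi 0, k x y :=
        setIntegral_nonneg measurableSet_Ioi fun x hx => hk_nonneg x y hx
      rw [norm_mul, Real.norm_of_nonneg hnn, ← integral_const_mul]
      refine setIntegral_congr_fun measurableSet_Ioi fun x hx => ?_
      simp only [Function.uncurry, norm_mul, Real.norm_of_nonneg (hk_nonneg x y hx)]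
  refine ⟨hF.integral_prod_left, ?_⟩
  rw [integral_integral_swap hF]
  simp only [integral_const_mul]

/-- Lower powers are dominated by the weight `1 + x ^ m`. -/
lemma rpow_le_one_add_rpow {x p m : ℝ} (hx : 0 < x) (hp : 0 ≤ p) (hpm : p ≤ m) :
    x ^ p ≤ 1 + x ^ m := by
  have hm0 : 0 ≤ x ^ m := Real.rpow_nonneg hx.le m
  rcases le_total x 1 with h | h
  · linarith [Real.rpow_le_one hx.le h hp]
  · linarith [Real.rpow_le_rpow_of_exponent_le h hpm]

/-- A function whose increments are integrals of `du` is minus the tail integral of `du`, provided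
`w x * x ^ p` is integrable for some `p ≥ 0`. -/
lemma eq_neg_integral_Ioi {w du : ℝ → ℝ} {p : ℝ} (hp : 0 ≤ p)
    (hdu_int : IntegrableOn du (Ioi 0))
    (hw_int : IntegrableOn (fun x => w x * x ^ p) (Ioi 0))
    (hw_meas : AEStronglyMeasurable w (volume.restrict (Ioi 0)))
    (hFTC : ∀ x₀ x₁ : ℝ, 0 < x₀ → x₀ ≤ x₁ → w x₁ - w x₀ = ∫ s in x₀..x₁, du s)
    {x : ℝ} (hx : 0 < x) : w x = -∫ s in Ioi x, du s := by
  have hlim : Tendsto w atTop (nhds (w x + ∫ s in Ioi x, du s)) := by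
    have h := (intervalIntegral_tendsto_integral_Ioi x
      (hdu_int.mono_set (Ioi_subset_Ioi hx.le)) tendsto_id).const_add (w x)
    refine h.congr' ?_
    filter_upwards [eventually_ge_atTop x] with y hy
    simp only [id]
    rw [← hFTC x y hx hy]
    ring
  have hw1 : IntegrableOn w (Ioi 1) := by
    refine Integrable.mono (hw_int.mono_set (Ioi_subset_Ioi zero_le_one))
      (hw_meas.mono_set (Ioi_subset_Ioi zero_le_one)) ?_
    filter_upwards [ae_restrict_mem measurableSet_Ioi] with y hy
    have hy1 : 1 ≤ y ^ p := Real.one_le_rpow (le_of_lt hy) hp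
    rw [norm_mul, Real.norm_of_nonneg (zero_le_one.trans hy1)]
    exact le_mul_of_one_le_right (norm_nonneg _) hy1
  have hzero : w x + ∫ s in Ioi x, du s = 0 := by
    refine IntegrableAtFilter.eq_zero_of_tendsto ⟨Ioi 1, Ioi_mem_atTop _, hw1⟩ ?_ hlim
    intro s hs
    rcases mem_atTop_sets.1 hs with ⟨c, hc⟩
    rw [← top_le_iff, ← Real.volume_Ici (a := c)]
    exact measure_mono hc
  linarith

/-- Integration by parts against `1 + x ^ m` on the half-line. -/
lemma integral_deriv_mul_one_add_rpow {w du : ℝ → ℝ} {m L : ℝ} (hm : 1 < m)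
    (hdu_int : IntegrableOn (fun x => du x * (1 + x ^ m)) (Ioi 0))
    (hw_int : IntegrableOn (fun x => w x * x ^ (m - 1)) (Ioi 0))
    (hw_meas : AEStronglyMeasurable w (volume.restrict (Ioi 0)))
    (hFTC : ∀ x₀ x₁ : ℝ, 0 < x₀ → x₀ ≤ x₁ → w x₁ - w x₀ = ∫ s in x₀..x₁, du s)
    (hL : Tendsto w (nhdsWithin 0 (Ioi 0)) (nhds L)) :
    ∫ x in Ioi 0, du x * (1 + x ^ m) = -(L + m * ∫ x in Ioi 0, w x * x ^ (m - 1)) := by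
  have hpos : ∀ x : ℝ, 0 < x → 0 < x ^ m := fun x hx => Real.rpow_pos_of_pos hx m
  have hdu_meas : AEStronglyMeasurable du (volume.restrict (Ioi 0)) := by
    have hinv : Measurable fun x : ℝ => (1 + x ^ m)⁻¹ := by fun_prop
    refine (hdu_int.1.mul hinv.aestronglyMeasurable).congr ?_
    filter_upwards [ae_restrict_mem measurableSet_Ioi] with x hx
    have := hpos x hx
    simp only [Pi.mul_apply]
    field_simp
  have hdu : IntegrableOn du (Ioi 0) := by
    refine Integrable.mono hdu_int hdu_meas ?_
    filter_upwards [ae_restrict_mem measurableSet_Ioi] with x hx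
    have := hpos x hx
    rw [norm_mul, Real.norm_of_nonneg (by linarith : 0 ≤ 1 + x ^ m)]
    exact le_mul_of_one_le_right (norm_nonneg _) (by linarith)
  have hdum : IntegrableOn (fun x => du x * x ^ m) (Ioi 0) := by
    refine (hdu_int.sub hdu).congr (Eventually.of_forall fun x => ?_)
    simp only [Pi.sub_apply]
    ring
  have hw_eq : ∀ x, 0 < x → w x = -∫ s in Ioi x, du s := fun x hx =>
    eq_neg_integral_Ioi (by linarith) hdu hw_int hw_meas hFTC hx
  have hL_eq : L = -∫ s in Ioi 0, du s := by
    refine tendsto_nhds_unique hL ?_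
    have hcont : Tendsto (fun x => ∫ s in (0:ℝ)..x, du s) (nhdsWithin 0 (Ioi 0)) (nhds 0) := by
      have hc := intervalIntegral.continuousOn_primitive_interval' (a := 0) (b₁ := 0) (b₂ := 1)
        (μ := volume) (f := du)
        ((intervalIntegrable_iff_integrableOn_Ioc_of_le zero_le_one).mpr
          (hdu.mono_set Ioc_subset_Ioi_self)) left_mem_uIcc
      have h0 := hc 0 left_mem_uIcc
      rw [uIcc_of_le zero_le_one] at h0
      have h1 := h0.mono_left (nhdsWithin_le_of_mem (t := Ioi 0)
        (mem_of_superset (Ioc_mem_nhdsGT zero_lt_one) Ioc_subset_Icc_self))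
      simpa using h1
    have h := (hcont.sub_const (∫ s in Ioi 0, du s))
    rw [zero_sub] at h
    refine h.congr' ?_
    filter_upwards [self_mem_nhdsWithin] with x hx
    rw [hw_eq x hx, ← intervalIntegral.integral_interval_add_Ioi hdu
      (hdu.mono_set (Ioi_subset_Ioi (le_of_lt hx)))]
    ring
  let k : ℝ → ℝ → ℝ := fun x s => if x < s then m * x ^ (m - 1) else 0
  have hk_meas : Measurable (Function.uncurry k) :=
    Measurable.ite (measurableSet_lt measurable_fst measurable_snd) (by fun_prop) measurable_const
  have hk_nonneg : ∀ x s, 0 < x → 0 ≤ k x s := by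
    intro x s hx
    have := Real.rpow_nonneg hx.le (m - 1)
    simp only [k]
    split_ifs <;> positivity
  have hk_supp : ∀ s x, s < x → k x s = 0 := fun s x h => if_neg h.not_gt
  have hk_Ioo : ∀ s, EqOn (fun x => k x s) (fun x => m * x ^ (m - 1)) (Ioo 0 s) :=
    fun s x hx => if_pos hx.2
  have hk_int : ∀ s, 0 < s → IntegrableOn (fun x => k x s) (Ioi 0) := by
    intro s hs
    refine IntegrableOn.of_ae_sdiff_eq_zero (s := Ioo 0 s) ?_
      measurableSet_Ioi.nullMeasurableSet (ae_diff_Ioo_eq_zero (hk_supp s))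
    refine IntegrableOn.congr_fun ?_ (hk_Ioo s).symm measurableSet_Ioo
    refine Integrable.const_mul ?_ m
    exact ((intervalIntegrable_iff_integrableOn_Ioc_of_le hs.le).mp
      (intervalIntegral.intervalIntegrable_rpow' (by linarith))).mono_set Ioo_subset_Ioc_self
  have hk_val : ∀ s, 0 < s → ∫ x in Ioi 0, k x s = s ^ m := by
    intro s hs
    rw [setIntegral_eq_of_subset_of_ae_sdiff_eq_zero measurableSet_Ioi.nullMeasurableSet
      Ioo_subset_Ioi_self (ae_diff_Ioo_eq_zero (hk_supp s)),
      setIntegral_congr_fun measurableSet_Ioo (hk_Ioo s), integral_const_mul,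
      ← integral_Ioc_eq_integral_Ioo, ← intervalIntegral.integral_of_le hs.le,
      integral_rpow (Or.inl (by linarith)), sub_add_cancel, Real.zero_rpow (by linarith)]
    field_simp
    ring
  have hgk_eq : EqOn (fun s => du s * ∫ x in Ioi 0, k x s) (fun s => du s * s ^ m) (Ioi 0) :=
    fun s hs => by simp only [hk_val s hs]
  have hswap := (integral_kernel_swap hk_meas hk_nonneg hk_int hdu_meas
    (hdum.congr_fun hgk_eq.symm measurableSet_Ioi)).2
  have hinner : EqOn (fun x => ∫ s in Ioi 0, du s * k x s)
      (fun x => -m * (w x * x ^ (m - 1))) (Ioi 0) := by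
    intro x hx
    have hsub : ∫ s in Ioi 0, du s * k x s = ∫ s in Ioi x, du s * k x s :=
      setIntegral_eq_of_subset_of_forall_sdiff_eq_zero measurableSet_Ioi
        (Ioi_subset_Ioi (le_of_lt hx)) fun s hs => by
          rw [show k x s = 0 from if_neg hs.2, mul_zero]
    have hval : ∫ s in Ioi x, du s * k x s = ∫ s in Ioi x, du s * (m * x ^ (m - 1)) :=
      setIntegral_congr_fun measurableSet_Ioi fun s hs => by
        simp only [k, if_pos (mem_Ioi.mp hs)]
    simp only
    rw [hsub, hval, integral_mul_const, hw_eq x hx]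
    ring
  rw [setIntegral_congr_fun measurableSet_Ioi hinner, integral_const_mul,
    setIntegral_congr_fun measurableSet_Ioi hgk_eq] at hswap
  have hsplit : ∫ x in Ioi 0, du x * (1 + x ^ m)
      = (∫ x in Ioi 0, du x) + ∫ x in Ioi 0, du x * x ^ m := by
    rw [← integral_add hdu hdum]
    simp only [mul_add, mul_one]
  rw [hsplit, ← hswap, hL_eq]
  ring

/-- A fragmentation kernel has integrable moments of every order `m ≥ 1`, and the `m`-th moment of
the daughters is at most the `m`-th power of the size of the parent. -/
lemma moment_le_rpow {f : ℝ → ℝ} {m y : ℝ} (hm : 1 ≤ m) (hy : 0 < y) (hf_meas : Measurable f)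
    (hf : ∀ x, 0 ≤ f x) (hint : IntegrableOn (fun x => x * f x) (Ioo 0 y))
    (hmass : ∫ x in Ioo 0 y, x * f x = y) :
    IntegrableOn (fun x => x ^ m * f x) (Ioo 0 y) ∧ ∫ x in Ioo 0 y, x ^ m * f x ≤ y ^ m := by
  have hle : ∀ x ∈ Ioo 0 y, x ^ m * f x ≤ y ^ (m - 1) * (x * f x) := by
    intro x hx
    have hxm : x ^ m = x ^ (m - 1) * x := by
      rw [← Real.rpow_add_one hx.1.ne', sub_add_cancel]
    have := Real.rpow_le_rpow hx.1.le hx.2.le (by linarith : 0 ≤ m - 1)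
    rw [hxm, mul_assoc]
    exact mul_le_mul_of_nonneg_right this (mul_nonneg hx.1.le (hf x))
  have hbd : IntegrableOn (fun x => y ^ (m - 1) * (x * f x)) (Ioo 0 y) := hint.const_mul _
  have hI : IntegrableOn (fun x => x ^ m * f x) (Ioo 0 y) := by
    refine Integrable.mono' hbd (by fun_prop) ?_
    filter_upwards [ae_restrict_mem measurableSet_Ioo] with x hx
    rw [Real.norm_of_nonneg (mul_nonneg (Real.rpow_nonneg hx.1.le m) (hf x))]
    exact hle x hx
  refine ⟨hI, (setIntegral_mono_on hI hbd measurableSet_Ioo hle).trans_eq ?_⟩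
  rw [integral_const_mul, hmass, ← Real.rpow_add_one hy.ne', sub_add_cancel]

/-- The moment identity of Lemma `est10`: for `u` in the domain of the
growth–fragmentation operator with McKendrick–von Foerster boundary condition,
`∫₀^∞ [(Z_{β,m}+B_m)u](x)(1+x^m) dx
  = ∫₀^∞ β u + m ∫₀^∞ r u x^{m-1} − ∫₀^∞ (N₀+N_m) a u`,
where `N_j(x) = x^j − n_j(x)` and `n_j(y) = ∫₀^y x^j b(x,y) dx`, and all integrals
converge absolutely. -/
theorem moment_identity (m l b₀ r₀ betam : ℝ) (r a β u du : ℝ → ℝ) (b : ℝ → ℝ → ℝ)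
    (hm : 1 < m) (hl0 : 0 ≤ l) (hlm : l ≤ m) (hb₀ : 1 ≤ b₀) (hr₀ : 0 < r₀)
    (hbetam : 0 ≤ betam)
    (hr_cont : ContinuousOn r (Ioi 0))
    (hr_pos : ∀ x, 0 < x → 0 < r x)
    (hr_bound : ∀ x, 0 < x → r x ≤ r₀ * (1 + x))
    (ha_meas : Measurable a) (ha_nonneg : ∀ x, 0 < x → 0 ≤ a x)
    (ha_locbdd : ∀ c, 0 < c → ∃ M, ∀ x ∈ Ioc (0:ℝ) c, a x ≤ M)
    (hβ_meas : Measurable β) (hβ_nonneg : ∀ x, 0 < x → 0 ≤ β x)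
    (hβ_bound : ∀ x, 0 < x → β x ≤ betam * (1 + x ^ m))
    (hb_meas : Measurable (Function.uncurry b))
    (hb_nonneg : ∀ x y, 0 ≤ b x y)
    (hb_supp : ∀ x y, y < x → b x y = 0)
    (hb_int : ∀ y, 0 < y → IntegrableOn (fun x => x * b x y) (Ioo 0 y) ∧
      IntegrableOn (fun x => b x y) (Ioo 0 y))
    (hmass : ∀ y, 0 < y → ∫ x in Ioo (0:ℝ) y, x * b x y = y)
    (hn0 : ∀ y, 0 < y → ∫ x in Ioo (0:ℝ) y, b x y ≤ b₀ * (1 + y ^ l))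
    (hu_meas : Measurable u) (hu_nonneg : ∀ x, 0 < x → 0 ≤ u x)
    (hu_int : IntegrableOn (fun x => u x * (1 + x ^ m)) (Ioi 0))
    (hau_int : IntegrableOn (fun x => a x * u x * (1 + x ^ m)) (Ioi 0))
    (hdu_int : IntegrableOn (fun x => du x * (1 + x ^ m)) (Ioi 0))
    (hFTC : ∀ x₀ x₁ : ℝ, 0 < x₀ → x₀ ≤ x₁ →
      r x₁ * u x₁ - r x₀ * u x₀ = ∫ s in x₀..x₁, du s)
    (hbc : Tendsto (fun x => r x * u x) (nhdsWithin 0 (Ioi 0))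
      (nhds (∫ x in Ioi 0, β x * u x))) :
    -- all integrals converge absolutely …
    IntegrableOn (fun x => (∫ y in Ioi x, a y * b x y * u y) * (1 + x ^ m)) (Ioi 0) ∧
    IntegrableOn (fun x => β x * u x) (Ioi 0) ∧
    IntegrableOn (fun x => r x * u x * x ^ (m - 1)) (Ioi 0) ∧
    IntegrableOn (fun x =>
      ((1 - ∫ z in Ioo (0:ℝ) x, b z x) + (x ^ m - ∫ z in Ioo (0:ℝ) x, z ^ m * b z x)) *
        (a x * u x)) (Ioi 0) ∧
    -- … and the identity holds
    ∫ x in Ioi 0, (-(du x) - a x * u x + ∫ y in Ioi x, a y * b x y * u y) * (1 + x ^ m)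
      = (∫ x in Ioi 0, β x * u x)
        + m * (∫ x in Ioi 0, r x * u x * x ^ (m - 1))
        - ∫ x in Ioi 0,
            ((1 - ∫ z in Ioo (0:ℝ) x, b z x) + (x ^ m - ∫ z in Ioo (0:ℝ) x, z ^ m * b z x)) *
              (a x * u x) := by
  have hwt : ∀ x : ℝ, 0 < x → 0 < 1 + x ^ m := fun x hx => by
    linarith [Real.rpow_pos_of_pos hx m]
  have hβu : IntegrableOn (fun x => β x * u x) (Ioi 0) := by
    refine Integrable.mono' (hu_int.const_mul betam)
      (hβ_meas.mul hu_meas).aestronglyMeasurable ?_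
    filter_upwards [ae_restrict_mem measurableSet_Ioi] with x hx
    rw [Real.norm_of_nonneg (mul_nonneg (hβ_nonneg x hx) (hu_nonneg x hx))]
    calc β x * u x ≤ betam * (1 + x ^ m) * u x :=
          mul_le_mul_of_nonneg_right (hβ_bound x hx) (hu_nonneg x hx)
      _ = betam * (u x * (1 + x ^ m)) := by ring
  have hru_meas : AEStronglyMeasurable (fun x => r x * u x) (volume.restrict (Ioi 0)) :=
    (hr_cont.aestronglyMeasurable measurableSet_Ioi).mul hu_meas.aestronglyMeasurable
  have hrux : IntegrableOn (fun x => r x * u x * x ^ (m - 1)) (Ioi 0) := by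
    refine Integrable.mono' (hu_int.const_mul (r₀ * 2))
      (hru_meas.mul (Measurable.aestronglyMeasurable (by fun_prop))) ?_
    filter_upwards [ae_restrict_mem measurableSet_Ioi] with x hx
    have hx0 : 0 < x := hx
    have hp : 0 ≤ x ^ (m - 1) := Real.rpow_nonneg hx0.le _
    have hxm : x ^ (m - 1) * x = x ^ m := by
      rw [← Real.rpow_add_one hx0.ne', sub_add_cancel]
    have hdom := rpow_le_one_add_rpow hx0 (by linarith : 0 ≤ m - 1) (by linarith : m - 1 ≤ m)
    rw [Real.norm_of_nonneg (mul_nonneg (mul_nonneg (hr_pos x hx).le (hu_nonneg x hx)) hp)]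
    calc r x * u x * x ^ (m - 1) ≤ r₀ * (1 + x) * u x * x ^ (m - 1) :=
          mul_le_mul_of_nonneg_right
            (mul_le_mul_of_nonneg_right (hr_bound x hx) (hu_nonneg x hx)) hp
      _ = r₀ * u x * (x ^ (m - 1) + x ^ (m - 1) * x) := by ring
      _ ≤ r₀ * u x * (2 * (1 + x ^ m)) :=
          mul_le_mul_of_nonneg_left (by linarith) (mul_nonneg hr₀.le (hu_nonneg x hx))
      _ = r₀ * 2 * (u x * (1 + x ^ m)) := by ring
  have hparts := integral_deriv_mul_one_add_rpow hm hdu_int hrux hru_meas hFTC hbc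
  have hb_sec : ∀ y, Measurable fun x => b x y := fun y => hb_meas.comp measurable_prodMk_right
  have hmom := fun y (hy : 0 < y) => moment_le_rpow hm.le hy (hb_sec y) (fun x => hb_nonneg x y)
    (hb_int y hy).1 (hmass y hy)
  let k : ℝ → ℝ → ℝ := fun x y => b x y * (1 + x ^ m)
  have hk_supp : ∀ y x, y < x → k x y = 0 := fun y x h => by simp only [k, hb_supp x y h, zero_mul]
  have hk_meas : Measurable (Function.uncurry k) :=
    hb_meas.mul (by fun_prop : Measurable fun p : ℝ × ℝ => 1 + p.1 ^ m)
  have hk_eq : ∀ y, (fun x => k x y) = fun x => b x y + x ^ m * b x y := fun y => by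
    funext x
    simp only [k]
    ring
  have hk_int : ∀ y, 0 < y → IntegrableOn (fun x => k x y) (Ioi 0) := by
    intro y hy
    refine IntegrableOn.of_ae_sdiff_eq_zero (s := Ioo 0 y) ?_
      measurableSet_Ioi.nullMeasurableSet (ae_diff_Ioo_eq_zero (hk_supp y))
    rw [hk_eq]
    exact (hb_int y hy).2.add (hmom y hy).1
  have hk_val : ∀ y, 0 < y → ∫ x in Ioi 0, k x y
      = (∫ z in Ioo 0 y, b z y) + ∫ z in Ioo 0 y, z ^ m * b z y := by
    intro y hy
    rw [setIntegral_eq_of_subset_of_ae_sdiff_eq_zero measurableSet_Ioi.nullMeasurableSet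
      Ioo_subset_Ioi_self (ae_diff_Ioo_eq_zero (hk_supp y)), hk_eq,
      integral_add (hb_int y hy).2 (hmom y hy).1]
  have hk_nonneg : ∀ x y, 0 < x → 0 ≤ k x y := fun x y hx =>
    mul_nonneg (hb_nonneg x y) (hwt x hx).le
  have hau_meas : AEStronglyMeasurable (fun y => a y * u y) (volume.restrict (Ioi 0)) :=
    (ha_meas.mul hu_meas).aestronglyMeasurable
  have hk_bound : ∀ y, 0 < y → ∫ x in Ioi 0, k x y ≤ (b₀ * 2 + 1) * (1 + y ^ m) := by
    intro y hy
    have hdom := rpow_le_one_add_rpow hy hl0 hlm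
    have hym := Real.rpow_pos_of_pos hy m
    have h0 := (hn0 y hy).trans (mul_le_mul_of_nonneg_left
      (by linarith : 1 + y ^ l ≤ 2 * (1 + y ^ m)) (by linarith : 0 ≤ b₀))
    rw [hk_val y hy]
    linarith [(hmom y hy).2]
  have hgk : IntegrableOn (fun y => a y * u y * ∫ x in Ioi 0, k x y) (Ioi 0) := by
    have hint_meas : StronglyMeasurable fun y => ∫ x in Ioi 0, k x y :=
      StronglyMeasurable.integral_prod_left hk_meas.stronglyMeasurable
    refine Integrable.mono' (hau_int.const_mul (b₀ * 2 + 1))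
      (hau_meas.mul hint_meas.aestronglyMeasurable) ?_
    filter_upwards [ae_restrict_mem measurableSet_Ioi] with y hy
    have hau : 0 ≤ a y * u y := mul_nonneg (ha_nonneg y hy) (hu_nonneg y hy)
    have hnn : 0 ≤ ∫ x in Ioi 0, k x y :=
      setIntegral_nonneg measurableSet_Ioi fun x hx => hk_nonneg x y hx
    rw [Real.norm_of_nonneg (mul_nonneg hau hnn)]
    calc a y * u y * ∫ x in Ioi 0, k x y ≤ a y * u y * ((b₀ * 2 + 1) * (1 + y ^ m)) :=
          mul_le_mul_of_nonneg_left (hk_bound y hy) hau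
      _ = (b₀ * 2 + 1) * (a y * u y * (1 + y ^ m)) := by ring
  obtain ⟨hB_int, hB_val⟩ := integral_kernel_swap hk_meas hk_nonneg hk_int hau_meas hgk
  have hB_eq : EqOn (fun x => ∫ y in Ioi 0, a y * u y * k x y)
      (fun x => (∫ y in Ioi x, a y * b x y * u y) * (1 + x ^ m)) (Ioi 0) := by
    intro x hx
    have hsub : ∫ y in Ioi 0, a y * u y * k x y = ∫ y in Ici x, a y * u y * k x y :=
      setIntegral_eq_of_subset_of_forall_sdiff_eq_zero measurableSet_Ioi
        (Ici_subset_Ioi.mpr hx) fun y hy => by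
          rw [hk_supp y x (not_le.mp hy.2), mul_zero]
    simp only
    rw [hsub, integral_Ici_eq_integral_Ioi, ← integral_mul_const]
    refine setIntegral_congr_fun measurableSet_Ioi fun y _ => ?_
    simp only [k]
    ring
  have hB := hB_int.congr_fun hB_eq measurableSet_Ioi
  have hN_eq : EqOn (fun x => a x * u x * (1 + x ^ m) - a x * u x * ∫ z in Ioi 0, k z x)
      (fun x => ((1 - ∫ z in Ioo (0:ℝ) x, b z x) + (x ^ m - ∫ z in Ioo (0:ℝ) x, z ^ m * b z x)) *
        (a x * u x)) (Ioi 0) := by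
    intro x hx
    simp only [hk_val x hx]
    ring
  have hN : IntegrableOn (fun x =>
      ((1 - ∫ z in Ioo (0:ℝ) x, b z x) + (x ^ m - ∫ z in Ioo (0:ℝ) x, z ^ m * b z x)) *
        (a x * u x)) (Ioi 0) :=
    IntegrableOn.congr_fun (hau_int.sub hgk) hN_eq measurableSet_Ioi
  refine ⟨hB, hβu, hrux, hN, ?_⟩
  have hsum : ∀ x, (-(du x) - a x * u x + ∫ y in Ioi x, a y * b x y * u y) * (1 + x ^ m)
      = (∫ y in Ioi x, a y * b x y * u y) * (1 + x ^ m) - a x * u x * (1 + x ^ m)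
        - du x * (1 + x ^ m) := fun x => by ring
  have hB_sub : IntegrableOn (fun x =>
      (∫ y in Ioi x, a y * b x y * u y) * (1 + x ^ m) - a x * u x * (1 + x ^ m)) (Ioi 0) :=
    hB.sub hau_int
  simp only [hsum]
  rw [integral_sub hB_sub hdu_int, integral_sub hB hau_int, hparts,
    ← setIntegral_congr_fun measurableSet_Ioi hB_eq, hB_val,
    ← setIntegral_congr_fun measurableSet_Ioi hN_eq, integral_sub hau_int hgk]
  ring
end
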